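/- arXiv:2010.00901 — 7 statements merged into one kernel-verified Lean document; each statement's English description precedes it below -/
import Mathlib

section
/- No-cut lemma: let L be a binary relational language, R a binary relation symbol not in L, Th ⊆ FO2(L) and Σ ⊆ FO2(L ∪ {R}) sets of sentences such that Σ is a weak implicit definition of R with respect to Th. If M is a transitive L-structure and R ⊆ M × M satisfies (M,R) ⊨ Th ∪ Σ, then R does not cut 2-types in M. -/
namespace AN

/-- Formulas of first-order logic over a binary relational language `L`
(a type whose elements are the binary relation symbols; there are no
function or constant symbols) with variables from `V`. -/
inductive FOV (L : Type) (V : Type) : Type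
  | eq : V → V → FOV L V
  | rel : L → V → V → FOV L V
  | not : FOV L V → FOV L V
  | and : FOV L V → FOV L V → FOV L V
  | ex : V → FOV L V → FOV L V

/-- An `L`-structure on universe `M`: an interpretation of each binary
relation symbol as a binary relation on `M`. -/
abbrev Str (L M : Type) := L → M → M → Prop

/-- Satisfaction of a formula in a structure under a valuation of the variables. -/
def Sat {L V M : Type} [DecidableEq V] (S : Str L M) : FOV L V → (V → M) → Prop
  | .eq i j, v => v i = v j
  | .rel r i j, v => S r (v i) (v j)
  | .not φ, v => ¬ Sat S φ v
  | .and φ ψ, v => Sat S φ v ∧ Sat S ψ v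
  | .ex i φ, v => ∃ m : M, Sat S φ (Function.update v i m)

/-- The free variables of a formula. -/
def Free {L V : Type} : FOV L V → Set V
  | .eq i j => {i, j}
  | .rel _ i j => {i, j}
  | .not φ => Free φ
  | .and φ ψ => Free φ ∪ Free ψ
  | .ex i φ => Free φ \ {i}

/-- A sentence is a formula with no free variables. -/
def Sentence {L V : Type} (φ : FOV L V) : Prop := Free φ = ∅

/-- The two-variable fragment FO2(L): formulas built from the two variables x, y. -/
abbrev FO2 (L : Type) := FOV L (Fin 2)

/-- The three-variable fragment FO3(L): formulas built from the three variables x, y, z. -/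
abbrev FO3 (L : Type) := FOV L (Fin 3)

/-- `M ⊨ φ[a,b]` : the FO2-formula φ holds with x interpreted as a and y as b. -/
def Sat2 {L M : Type} (S : Str L M) (φ : FO2 L) (a b : M) : Prop :=
  Sat S φ ![a, b]

/-- The 2-type of the pair (a,b) in the structure: all FO2-formulas true of (a,b). -/
def Type2 {L M : Type} (S : Str L M) (a b : M) : Set (FO2 L) :=
  {φ | Sat2 S φ a b}

/-- `f` is an automorphism of the structure `S`. -/
def IsAuto {L M : Type} (S : Str L M) (f : M ≃ M) : Prop :=
  ∀ r a b, S r a b ↔ S r (f a) (f b)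

/-- A structure is transitive if any two elements of the same type are
connected by an automorphism. -/
def IsTransitive {L M : Type} (S : Str L M) : Prop :=
  ∀ a b : M, Type2 S a a = Type2 S b b →
    ∃ f : M ≃ M, IsAuto S f ∧ f a = b

/-- A structure is 2-homogeneous if whenever a and b have the same type,
every c can be matched by some d with Type(a,c) = Type(b,d). -/
def IsHomog2 {L M : Type} (S : Str L M) : Prop :=
  ∀ a b c : M, Type2 S a a = Type2 S b b →
    ∃ d : M, Type2 S a c = Type2 S b d

/-- A 2-partial isomorphism between `S` and `T`, presented by its part `i1`
relating elements and its part `i2` relating pairs. -/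
structure IsTwoIso {L M N : Type} (S : Str L M) (T : Str L N)
    (i1 : M → N → Prop) (i2 : M → M → N → N → Prop) : Prop where
  eq_iff : ∀ a b a' b', i2 a b a' b' → (a = b ↔ a' = b')
  rel_iff2 : ∀ a b a' b', i2 a b a' b' → ∀ r,
      (S r a a ↔ T r a' a') ∧ (S r a b ↔ T r a' b') ∧
      (S r b a ↔ T r b' a') ∧ (S r b b ↔ T r b' b')
  rel_iff1 : ∀ a a', i1 a a' → ∀ r, S r a a ↔ T r a' a'
  restrict : ∀ a b a' b', i2 a b a' b' → i1 a a' ∧ i1 b b'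
  forth1 : ∀ a, ∃ a', i1 a a'
  back1 : ∀ a', ∃ a, i1 a a'
  forth2 : ∀ a a', i1 a a' → ∀ b, ∃ b', i2 a b a' b'
  back2 : ∀ a a', i1 a a' → ∀ b', ∃ b, i2 a b a' b'

/-- Two structures are 2-isomorphic when some 2-partial isomorphism between
them exists. -/
def TwoIsomorphic {L M N : Type} (S : Str L M) (T : Str L N) : Prop :=
  ∃ i1 i2, IsTwoIso S T i1 i2

/-- 2-equivalence: the same FO2 sentences hold in both structures. -/
def Equiv2 {L M N : Type} (S : Str L M) (T : Str L N) : Prop :=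
  ∀ φ : FO2 L, Sentence φ → ((∀ v, Sat S φ v) ↔ (∀ v, Sat T φ v))

/-- 3-equivalence: the same FO3 sentences hold in both structures. -/
def Equiv3 {L M N : Type} (S : Str L M) (T : Str L N) : Prop :=
  ∀ φ : FO3 L, Sentence φ → ((∀ v, Sat S φ v) ↔ (∀ v, Sat T φ v))

/-- Expansion of an `L`-structure by one new binary relation `R`; the new
relation symbol is `Sum.inr ()`, so the expanded language is `L ⊕ Unit`. -/
def expand {L M : Type} (S : Str L M) (R : M → M → Prop) : Str (L ⊕ Unit) M :=
  Sum.elim S (fun _ => R)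

/-- `S` is a model of the set `Th` of sentences. -/
def ModelsSet {L V M : Type} [DecidableEq V] (S : Str L M) (Th : Set (FOV L V)) : Prop :=
  ∀ φ ∈ Th, ∀ v : V → M, Sat S φ v

/-- `Sg` is a weak implicit definition of the new relation symbol w.r.t. `Th`:
in each model of `Th` there is at most one relation satisfying `Sg`. -/
def WeakImplicitDef (L : Type) (Th : Set (FO2 L)) (Sg : Set (FO2 (L ⊕ Unit))) : Prop :=
  ∀ (M : Type) (S : Str L M), Nonempty M → ModelsSet S Th →
    ∀ R R' : M → M → Prop,
      ModelsSet (expand S R) Sg → ModelsSet (expand S R') Sg → R = R'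

/-- `Sg` is a strong implicit definition of the new relation symbol w.r.t. `Th`:
in each model of `Th` there is exactly one relation satisfying `Sg`. -/
def StrongImplicitDef (L : Type) (Th : Set (FO2 L)) (Sg : Set (FO2 (L ⊕ Unit))) : Prop :=
  ∀ (M : Type) (S : Str L M), Nonempty M → ModelsSet S Th →
    ∃! R : M → M → Prop, ModelsSet (expand S R) Sg

/-- `Sg` can be made explicit w.r.t. `Th`: there is an FO2(L)-formula φ(x,y)
with Th ∪ Sg ⊨ ∀x∀y (R(x,y) ↔ φ(x,y)). -/
def MadeExplicit (L : Type) (Th : Set (FO2 L)) (Sg : Set (FO2 (L ⊕ Unit))) : Prop :=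
  ∃ φ : FO2 L, ∀ (M : Type) (S : Str L M), Nonempty M → ModelsSet S Th →
    ∀ R : M → M → Prop, ModelsSet (expand S R) Sg →
      ∀ a b : M, R a b ↔ Sat2 S φ a b

/-- `R` does not cut 2-types in `S`. -/
def NoCut {L M : Type} (S : Str L M) (R : M → M → Prop) : Prop :=
  ∀ a b c d : M, Type2 S a b = Type2 S c d → (R a b ↔ R c d)

/-- The valuation sending the variable `0` (i.e. x) to `m` and the variables
`1,…,k` (the constants naming the tuple `t`) to the entries of `t`. -/
def valCons {M : Type} (m : M) {k : ℕ} (t : Fin k → M) : ℕ → M :=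
  fun i => if h : 0 < i ∧ i - 1 < k then t ⟨i - 1, h.2⟩ else m

/-- ω-saturation, phrased with formulas whose free variables are among
x = variable 0 and the constants = variables 1,…,k naming a finite tuple t:
if every finite subset of Γ(x) is satisfiable in (M,t), then Γ(x) is realized. -/
def OmegaSaturated {L M : Type} (S : Str L M) : Prop :=
  ∀ (k : ℕ) (t : Fin k → M) (Γ : Set (FOV L ℕ)),
    (∀ φ ∈ Γ, Free φ ⊆ {i | i ≤ k}) →
    (∀ Γ₀ : Finset (FOV L ℕ), ↑Γ₀ ⊆ Γ →
        ∃ m : M, ∀ φ ∈ Γ₀, Sat S φ (valCons m t)) →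
    ∃ m : M, ∀ φ ∈ Γ, Sat S φ (valCons m t)

/-- The new relation symbol cannot cut the formula π:
Th ∪ Sg ⊨ ∀x∀y(π → R(x,y)) or Th ∪ Sg ⊨ ∀x∀y(π → ¬R(x,y)). -/
def CannotCut (L : Type) (Th : Set (FO2 L)) (Sg : Set (FO2 (L ⊕ Unit))) (π : FO2 L) : Prop :=
  (∀ (M : Type) (S : Str L M), Nonempty M → ModelsSet S Th →
      ∀ R : M → M → Prop, ModelsSet (expand S R) Sg →
        ∀ a b : M, Sat2 S π a b → R a b) ∨
  (∀ (M : Type) (S : Str L M), Nonempty M → ModelsSet S Th →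
      ∀ R : M → M → Prop, ModelsSet (expand S R) Sg →
        ∀ a b : M, Sat2 S π a b → ¬ R a b)

/-- `π` is a 2-partition with respect to Th ∪ Sg: Th ∪ Sg ⊨ ∀x∀y ⋁ᵢ πᵢ and
Th ∪ Sg ⊨ ∀x∀y ¬(πᵢ ∧ πⱼ) for i < j. -/
def IsTwoPartition (L : Type) (Th : Set (FO2 L)) (Sg : Set (FO2 (L ⊕ Unit)))
    {n : ℕ} (π : Fin (n + 1) → FO2 L) : Prop :=
  ∀ (M : Type) (S : Str L M), Nonempty M → ModelsSet S Th →
    ∀ R : M → M → Prop, ModelsSet (expand S R) Sg →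
      (∀ a b : M, ∃ i, Sat2 S (π i) a b) ∧
      (∀ a b : M, ∀ i j : Fin (n + 1), i < j →
        ¬(Sat2 S (π i) a b ∧ Sat2 S (π j) a b))

/-- The binary relation defined in `S` by an FO3-formula ρ(x,y) with free
variables among x = 0 and y = 1 (the value of z is immaterial). -/
def rel3 {L M : Type} (S : Str L M) (ρ : FO3 L) : Set (M × M) :=
  {p | Sat S ρ ![p.1, p.2, p.2]}

/-- The FO3-definable binary relations of `S`. -/
def Def3 {L M : Type} (S : Str L M) : Set (Set (M × M)) :=
  {Z | ∃ ρ : FO3 L, Free ρ ⊆ ({0, 1} : Set (Fin 3)) ∧ Z = rel3 S ρ}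

/-- Converse of a binary relation. -/
def conv {M : Type} (Z : Set (M × M)) : Set (M × M) := {p | (p.2, p.1) ∈ Z}

/-- Composition of binary relations. -/
def comp {M : Type} (Z W : Set (M × M)) : Set (M × M) :=
  {p | ∃ v, (p.1, v) ∈ Z ∧ (v, p.2) ∈ W}

section TwoIso

variable {L M N : Type} {S : Str L M} {T : Str L N}
  {i1 : M → N → Prop} {i2 : M → M → N → N → Prop}

/-- A 2-partial isomorphism preserves FO2-formulas, in both orders of the pair. -/
theorem IsTwoIso.sat_iff (h : IsTwoIso S T i1 i2) (φ : FO2 L) :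
    ∀ a b a' b', i2 a b a' b' →
      (Sat S φ ![a, b] ↔ Sat T φ ![a', b']) ∧ (Sat S φ ![b, a] ↔ Sat T φ ![b', a']) := by
  have u0 : ∀ {K : Type} (p q m : K), Function.update ![p, q] 0 m = ![m, q] := by
    intro K p q m; ext i; fin_cases i <;> simp
  have u1 : ∀ {K : Type} (p q m : K), Function.update ![p, q] 1 m = ![p, m] := by
    intro K p q m; ext i; fin_cases i <;> simp
  induction φ with
  | eq i j =>
    intro a b a' b' hi
    have he := h.eq_iff _ _ _ _ hi
    fin_cases i <;> fin_cases j <;> simp [Sat, he, eq_comm (a := b), eq_comm (a := b')]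
  | rel r i j =>
    intro a b a' b' hi
    obtain ⟨h1, h2, h3, h4⟩ := h.rel_iff2 _ _ _ _ hi r
    fin_cases i <;> fin_cases j <;> simp [Sat, h1, h2, h3, h4]
  | not φ ih =>
    intro a b a' b' hi
    exact ⟨not_congr (ih _ _ _ _ hi).1, not_congr (ih _ _ _ _ hi).2⟩
  | and φ ψ ih ih' =>
    intro a b a' b' hi
    exact ⟨and_congr (ih _ _ _ _ hi).1 (ih' _ _ _ _ hi).1,
      and_congr (ih _ _ _ _ hi).2 (ih' _ _ _ _ hi).2⟩
  | ex i φ ih =>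
    intro a b a' b' hi
    obtain ⟨ha, hb⟩ := h.restrict _ _ _ _ hi
    have fst : ∀ p p', i1 p p' → ((∃ m, Sat S φ ![p, m]) ↔ ∃ m, Sat T φ ![p', m]) := by
      intro p p' hp
      constructor
      · rintro ⟨m, hm⟩
        obtain ⟨m', hm'⟩ := h.forth2 p p' hp m
        exact ⟨m', (ih _ _ _ _ hm').1.1 hm⟩
      · rintro ⟨m', hm⟩
        obtain ⟨m, hm'⟩ := h.back2 p p' hp m'
        exact ⟨m, (ih _ _ _ _ hm').1.2 hm⟩
    have snd : ∀ p p', i1 p p' → ((∃ m, Sat S φ ![m, p]) ↔ ∃ m, Sat T φ ![m, p']) := by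
      intro p p' hp
      constructor
      · rintro ⟨m, hm⟩
        obtain ⟨m', hm'⟩ := h.forth2 p p' hp m
        exact ⟨m', (ih _ _ _ _ hm').2.1 hm⟩
      · rintro ⟨m', hm⟩
        obtain ⟨m, hm'⟩ := h.back2 p p' hp m'
        exact ⟨m, (ih _ _ _ _ hm').2.2 hm⟩
    fin_cases i
    · simpa [Sat, u0] using And.intro (snd _ _ hb) (snd _ _ ha)
    · simpa [Sat, u1] using And.intro (fst _ _ ha) (fst _ _ hb)

theorem IsTwoIso.modelsSet (h : IsTwoIso S T i1 i2) {Th : Set (FO2 L)}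
    (hS : ModelsSet S Th) : ModelsSet T Th := by
  intro φ hφ v
  obtain ⟨a, ha⟩ := h.back1 (v 0)
  obtain ⟨b, hb⟩ := h.back2 _ _ ha (v 1)
  have hv : v = ![v 0, v 1] := by ext i; fin_cases i <;> rfl
  rw [hv]
  exact (h.sat_iff φ _ _ _ _ hb).1.1 (hS φ hφ _)

/-- Forgetting the new relation keeps a 2-partial isomorphism. -/
theorem IsTwoIso.of_expand {R : M → M → Prop} {Q : N → N → Prop}
    (h : IsTwoIso (expand S R) (expand T Q) i1 i2) : IsTwoIso S T i1 i2 where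
  eq_iff := h.eq_iff
  rel_iff2 a b a' b' hi r := h.rel_iff2 a b a' b' hi (Sum.inl r)
  rel_iff1 a a' hi r := h.rel_iff1 a a' hi (Sum.inl r)
  restrict := h.restrict
  forth1 := h.forth1
  back1 := h.back1
  forth2 := h.forth2
  back2 := h.back2

/-- An isomorphism is a 2-partial isomorphism. -/
theorem isTwoIso_of_equiv (f : M ≃ N) (hf : ∀ r a b, S r a b ↔ T r (f a) (f b)) :
    IsTwoIso S T (fun a a' => f a = a') (fun a b a' b' => f a = a' ∧ f b = b') where
  eq_iff := by rintro a b _ _ ⟨rfl, rfl⟩; simp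
  rel_iff2 := by
    rintro a b _ _ ⟨rfl, rfl⟩ r
    exact ⟨hf _ _ _, hf _ _ _, hf _ _ _, hf _ _ _⟩
  rel_iff1 := by rintro a _ rfl r; exact hf _ _ _
  restrict _ _ _ _ h := h
  forth1 a := ⟨_, rfl⟩
  back1 a' := ⟨f.symm a', by simp⟩
  forth2 a a' h b := ⟨_, h, rfl⟩
  back2 a a' h b' := ⟨f.symm b', h, by simp⟩

end TwoIso

section Auto

variable {L M : Type} {S : Str L M}

theorem IsAuto.refl : IsAuto S (Equiv.refl M) := fun _ _ _ => Iff.rfl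

theorem IsAuto.symm {f : M ≃ M} (hf : IsAuto S f) : IsAuto S f.symm := fun r a b => by
  simpa using (hf r (f.symm a) (f.symm b)).symm

theorem IsAuto.trans {f g : M ≃ M} (hf : IsAuto S f) (hg : IsAuto S g) :
    IsAuto S (f.trans g) := fun r a b => (hf r a b).trans (hg r (f a) (f b))

/-- The pullback of a structure on `M` to `N`, where each pair of elements of `N` takes its
atomic relations from a prescribed pair of elements of `M`. -/
def pairPullback {N : Type} (S : Str L M) (P : N → N → M × M) : Str L N :=
  fun r x y => S r (P x y).1 (P x y).2

/-- If `P` is compatible with `π : N → M` up to automorphisms and each pair starting with `π x`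
is prescribed for some pair starting with `x`, then `S` is 2-isomorphic to its pullback. -/
theorem isTwoIso_pairPullback {N : Type} {P : N → N → M × M} {π : N → M}
    (hπ : Function.Surjective π) (hne : ∀ x y, x ≠ y → (P x y).1 ≠ (P x y).2)
    (hdiag : ∀ x, P x x = (π x, π x)) (hswap : ∀ x y, P y x = (P x y).swap)
    (horb : ∀ x y, ∃ g, IsAuto S g ∧ g (π x) = (P x y).1)
    (hext : ∀ x n, ∃ y, P x y = (π x, n)) :
    IsTwoIso S (pairPullback S P) (fun m x => ∃ g, IsAuto S g ∧ g m = π x)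
      (fun m n x y => ∃ g, IsAuto S g ∧ g m = (P x y).1 ∧ g n = (P x y).2) := by
  have hres : ∀ m n x y, (∃ g, IsAuto S g ∧ g m = (P x y).1 ∧ g n = (P x y).2) →
      (∃ g, IsAuto S g ∧ g m = π x) ∧ (∃ g, IsAuto S g ∧ g n = π y) := by
    rintro m n x y ⟨g, hg, h1, h2⟩
    obtain ⟨k, hk, hk'⟩ := horb x y
    obtain ⟨l, hl, hl'⟩ := horb y x
    rw [hswap x y] at hl'
    refine ⟨⟨g.trans k.symm, hg.trans hk.symm, ?_⟩, ⟨g.trans l.symm, hg.trans hl.symm, ?_⟩⟩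
    · simp [h1, ← hk']
    · simp only [Prod.fst_swap] at hl'
      simp [h2, ← hl']
  have hone : ∀ m x, (∃ g, IsAuto S g ∧ g m = π x) →
      ∀ r, S r m m ↔ pairPullback S P r x x := by
    rintro m x ⟨g, hg, h⟩ r
    rw [hg r m m, h]
    simp [pairPullback, hdiag]
  refine ⟨?_, ?_, hone, hres, ?_, ?_, ?_, ?_⟩
  · rintro m n x y ⟨g, hg, h1, h2⟩
    rw [← g.injective.eq_iff, h1, h2]
    constructor
    · intro h
      by_contra hxy
      exact hne x y hxy h
    · rintro rfl
      simp [hdiag]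
  · intro m n x y h r
    obtain ⟨hm, hn⟩ := hres m n x y h
    obtain ⟨g, hg, h1, h2⟩ := h
    refine ⟨hone _ _ hm r, ?_, ?_, hone _ _ hn r⟩
    · rw [hg r, h1, h2]; rfl
    · rw [hg r, h1, h2]; simp [pairPullback, hswap x y]
  · intro m
    obtain ⟨x, hx⟩ := hπ m
    exact ⟨x, Equiv.refl M, IsAuto.refl, hx.symm⟩
  · intro x
    exact ⟨π x, Equiv.refl M, IsAuto.refl, rfl⟩
  · rintro m x ⟨g, hg, h⟩ n
    obtain ⟨y, hy⟩ := hext x (g n)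
    exact ⟨y, g, hg, by simp [hy, h], by simp [hy]⟩
  · rintro m x ⟨g, hg, h⟩ y
    obtain ⟨k, hk, hk'⟩ := horb x y
    exact ⟨(g.trans k).symm (P x y).2, g.trans k, hg.trans hk, by simp [h, hk'], by simp⟩

end Auto

section Duplication

variable {M : Type}

/-- The projection to `M` of the universe obtained by adding a second copy of `a`
(`inr false`) and of `b` (`inr true`). -/
def dupProj (a b : M) : M ⊕ Bool → M
  | .inl m => m
  | .inr false => a
  | .inr true => b

open Classical in
/-- The prescribed pairs on the universe with `a` and `b` duplicated: the original pair `(a, b)`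
is prescribed as `(a, d)`, and an element and its copy are prescribed as `(a, a')`
or `(b, b')`; all other pairs are projected. -/
noncomputable def dupPair (a b a' b' d : M) : M ⊕ Bool → M ⊕ Bool → M × M
  | .inl m, .inl n =>
    if m = a ∧ n = b then (a, d) else if m = b ∧ n = a then (d, a) else (m, n)
  | .inl m, .inr false => if m = a then (a, a') else (m, a)
  | .inl m, .inr true => if m = b then (b, b') else (m, b)
  | .inr false, .inl m => if m = a then (a', a) else (a, m)
  | .inr true, .inl m => if m = b then (b', b) else (b, m)
  | .inr i, .inr j => (dupProj a b (.inr i), dupProj a b (.inr j))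

theorem isTwoIso_dupPair {L : Type} {S : Str L M} {a b a' b' d : M} (hab : a ≠ b)
    (ha' : a ≠ a') (hb' : b ≠ b') (had : a ≠ d)
    (ga : ∃ g, IsAuto S g ∧ g a = a') (gb : ∃ g, IsAuto S g ∧ g b = b')
    (gd : ∃ g, IsAuto S g ∧ g b = d) :
    IsTwoIso S (pairPullback S (dupPair a b a' b' d))
      (fun m x => ∃ g, IsAuto S g ∧ g m = dupProj a b x)
      (fun m n x y => ∃ g, IsAuto S g ∧ g m = (dupPair a b a' b' d x y).1 ∧
        g n = (dupPair a b a' b' d x y).2) := by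
  have gr : ∀ m, ∃ g, IsAuto S g ∧ g m = m := fun m => ⟨Equiv.refl M, IsAuto.refl, rfl⟩
  apply isTwoIso_pairPullback
  · exact fun m => ⟨.inl m, rfl⟩
  · rintro (m | _ | _) (n | _ | _) h <;> simp only [dupPair, dupProj] <;> grind
  · rintro (m | _ | _) <;> simp only [dupPair, dupProj] <;> grind
  · rintro (m | _ | _) (n | _ | _) <;> simp only [dupPair, dupProj] <;> grind
  · rintro (m | _ | _) (n | _ | _) <;> simp only [dupPair, dupProj] <;> (try split_ifs) <;>
      simp_all only
  · rintro (m | _ | _) n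
    · by_cases h1 : m = a ∧ n = b
      · exact ⟨.inr true, by simp only [dupPair, dupProj]; grind⟩
      · by_cases h2 : m = b ∧ n = a
        · exact ⟨.inr false, by simp only [dupPair, dupProj]; grind⟩
        · exact ⟨.inl n, by simp only [dupPair, dupProj]; grind⟩
    · by_cases h : n = a
      · exact ⟨.inr false, by simp only [dupPair, dupProj]; grind⟩
      · exact ⟨.inl n, by simp only [dupPair, dupProj]; grind⟩
    · by_cases h : n = b
      · exact ⟨.inr true, by simp only [dupPair, dupProj]; grind⟩
      · exact ⟨.inl n, by simp only [dupPair, dupProj]; grind⟩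

theorem pairPullback_dupPair_congr {L : Type} {S : Str L M} {a b a' b' d e : M}
    (h1 : ∀ r, S r a d ↔ S r a e) (h2 : ∀ r, S r d a ↔ S r e a) :
    pairPullback S (dupPair a b a' b' d) = pairPullback S (dupPair a b a' b' e) := by
  funext r x y
  rcases x with m | _ | _ <;> rcases y with n | _ | _ <;>
    simp only [pairPullback, dupPair] <;> split_ifs <;> simp [h1, h2]

end Duplication

section WeakImplicit

variable {L M : Type} {Th : Set (FO2 L)} {Sg : Set (FO2 (L ⊕ Unit))} {S : Str L M}
  {R : M → M → Prop}

/-- A weakly implicitly defined relation is invariant under automorphisms. -/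
theorem WeakImplicitDef.isAuto_expand (hweak : WeakImplicitDef L Th Sg)
    (hMTh : ModelsSet S Th) (hMSg : ModelsSet (expand S R) Sg)
    {f : M ≃ M} (hf : IsAuto S f) : IsAuto (expand S R) f := by
  rintro (r | _) a b
  · exact hf r a b
  · have hmod : ModelsSet (expand S fun x y => R (f x) (f y)) Sg := by
      refine (isTwoIso_of_equiv f.symm ?_).modelsSet hMSg
      rintro (r | _) x y
      · exact hf.symm r x y
      · simp [expand]
    have := hweak M S ⟨a⟩ hMTh _ _ hMSg hmod
    exact iff_of_eq (congrFun (congrFun this a) b)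

/-- A weakly implicitly defined relation does not separate `(a, b)` from `(a, d)` when these pairs
have the same atomic relations and an automorphism takes `b` to `d`. -/
theorem WeakImplicitDef.iff_of_isAuto (hweak : WeakImplicitDef L Th Sg)
    (hMTh : ModelsSet S Th) (hMSg : ModelsSet (expand S R) Sg) {a b d : M}
    (hab : a ≠ b) (had : a ≠ d) (h1 : ∀ r, S r a b ↔ S r a d) (h2 : ∀ r, S r b a ↔ S r d a)
    {g : M ≃ M} (hg : IsAuto S g) (hgb : g b = d) : R a b ↔ R a d := by
  by_contra hR
  have hgR := hweak.isAuto_expand hMTh hMSg hg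
  have hga : a ≠ g a := by
    intro h
    apply hR
    have := hgR (Sum.inr ()) a b
    rw [← h, hgb] at this
    exact this
  have hbd : b ≠ d := by
    rintro rfl
    exact hR Iff.rfl
  have split : ∀ c, pairPullback (expand S R) (dupPair a b (g a) d c) =
      expand (pairPullback S (dupPair a b (g a) d c))
        (fun x y => R (dupPair a b (g a) d c x y).1 (dupPair a b (g a) d c x y).2) := by
    intro c
    funext r
    cases r <;> rfl
  have iso_b := isTwoIso_dupPair hab hga hbd hab ⟨g, hgR, rfl⟩ ⟨g, hgR, hgb⟩
    ⟨Equiv.refl M, IsAuto.refl, rfl⟩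
  have iso_d := isTwoIso_dupPair hab hga hbd had ⟨g, hgR, rfl⟩ ⟨g, hgR, hgb⟩ ⟨g, hgR, hgb⟩
  rw [split] at iso_b iso_d
  have mod_d := iso_d.modelsSet hMSg
  rw [← pairPullback_dupPair_congr h1 h2] at mod_d
  have heq := hweak _ _ ⟨.inl a⟩ (iso_b.of_expand.modelsSet hMTh) _ _
    (iso_b.modelsSet hMSg) mod_d
  apply hR
  simpa [dupPair] using congrFun (congrFun heq (.inl a)) (.inl b)

end WeakImplicit

section Types

variable {L M : Type} {S : Str L M} {a b c d : M}

theorem Type2_fst (h : Type2 S a b = Type2 S c d) : Type2 S a a = Type2 S c c := by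
  have key : ∀ (φ : FO2 L) (p q : M), FOV.ex 1 (.and (.eq 0 1) φ) ∈ Type2 S p q ↔
      φ ∈ Type2 S p p := by
    intro φ p q
    have u : ∀ m, Function.update ![p, q] 1 m = ![p, m] := by
      intro m; ext i; fin_cases i <;> simp
    simp [Type2, Sat2, Sat, u]
  ext φ
  rw [← key φ a b, ← key φ c d, h]

theorem Type2_snd (h : Type2 S a b = Type2 S c d) : Type2 S b b = Type2 S d d := by
  have key : ∀ (φ : FO2 L) (p q : M), FOV.ex 0 (.and (.eq 0 1) φ) ∈ Type2 S p q ↔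
      φ ∈ Type2 S q q := by
    intro φ p q
    have u : ∀ m, Function.update ![p, q] 0 m = ![m, q] := by
      intro m; ext i; fin_cases i <;> simp
    simp [Type2, Sat2, Sat, u]
  ext φ
  rw [← key φ a b, ← key φ c d, h]

theorem Type2_eq_iff (h : Type2 S a b = Type2 S c d) : a = b ↔ c = d := by
  simpa [Type2, Sat2, Sat] using Set.ext_iff.1 h (.eq 0 1)

theorem Type2_rel_iff (h : Type2 S a b = Type2 S c d) (r : L) : S r a b ↔ S r c d := by
  simpa [Type2, Sat2, Sat] using Set.ext_iff.1 h (.rel r 0 1)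

theorem Type2_rel_swap_iff (h : Type2 S a b = Type2 S c d) (r : L) :
    S r b a ↔ S r d c := by
  simpa [Type2, Sat2, Sat] using Set.ext_iff.1 h (.rel r 1 0)

end Types

/-- No-cut lemma: if Σ is a weak implicit definition of R w.r.t.
Th, M is transitive and (M,R) ⊨ Th ∪ Σ, then R does not cut 2-types in M. -/
theorem stmt5 (L : Type) (Th : Set (FO2 L)) (Sg : Set (FO2 (L ⊕ Unit)))
    (hTh : ∀ φ ∈ Th, Sentence φ) (hSg : ∀ φ ∈ Sg, Sentence φ)
    (hweak : WeakImplicitDef L Th Sg)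
    (M : Type) [Nonempty M] (S : Str L M) (R : M → M → Prop)
    (htr : IsTransitive S)
    (hMTh : ModelsSet S Th) (hMSg : ModelsSet (expand S R) Sg) :
    NoCut S R := by
  intro a b c d h
  obtain ⟨f, hf, rfl⟩ := htr _ _ (Type2_fst h)
  have hfR : R a b ↔ R (f a) (f b) := hweak.isAuto_expand hMTh hMSg hf (Sum.inr ()) a b
  rw [hfR]
  by_cases hab : a = b
  · rw [← (Type2_eq_iff h).1 hab, hab]
  · obtain ⟨k, hk, hkb⟩ := htr _ _ (Type2_snd h)
    refine hweak.iff_of_isAuto hMTh hMSg (f.injective.ne hab)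
      (fun e => hab ((Type2_eq_iff h).2 e)) (fun r => ?_) (fun r => ?_)
      (hf.symm.trans hk) (by simpa using hkb)
    · rw [← hf r, Type2_rel_iff h]
    · rw [← hf r, Type2_rel_swap_iff h]

end AN
end

section
/- Cut lemma: let L be a binary relational language, R a binary relation symbol not in L, Th ⊆ FO2(L) and Σ ⊆ FO2(L ∪ {R}) sets of sentences such that Σ is a weak implicit definition of R with respect to Th. Then the following are equivalent: (i) Σ can be made explicit with respect to Th by an FO2(L)-formula; (ii) for every L-structure M and every R ⊆ M × M with (M,R) ⊨ Th ∪ Σ, R does not cut 2-types in M; (iii) for every 2-homogeneous L-structure M and every R ⊆ M × M with (M,R) ⊨ Th ∪ Σ, R does not cut 2-types in M. -/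
namespace AN

/-- Translation of formulas along maps of relation symbols and of variables. -/
def FOV.map {L L' V V' : Type} (r : L → L') (s : V → V') : FOV L V → FOV L' V'
  | .eq i j => .eq (s i) (s j)
  | .rel R i j => .rel (r R) (s i) (s j)
  | .not φ => .not (φ.map r s)
  | .and φ ψ => .and (φ.map r s) (ψ.map r s)
  | .ex i φ => .ex (s i) (φ.map r s)

theorem sat_map {L L' V V' M : Type} [DecidableEq V] [DecidableEq V'] (T : Str L' M)
    (r : L → L') {s : V → V'} (hs : Function.Injective s) (φ : FOV L V) (v : V' → M) :
    Sat T (φ.map r s) v ↔ Sat (fun R => T (r R)) φ (v ∘ s) := by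
  induction φ generalizing v with
  | eq i j => rfl
  | rel R i j => rfl
  | not φ ih => exact not_congr (ih v)
  | and φ ψ ih₁ ih₂ => exact and_congr (ih₁ v) (ih₂ v)
  | ex i φ ih =>
    refine exists_congr fun m => ?_
    rw [ih, Function.update_comp_eq_of_injective v hs i m]

/-- The reduct to `L` of a structure for `L` with one additional relation symbol. -/
abbrev reduct {L M : Type} (T : Str (L ⊕ Unit) M) : Str L M := fun R => T (Sum.inl R)

theorem sat_map_inl {L M : Type} (T : Str (L ⊕ Unit) M) (φ : FO2 L) (v : Fin 2 → M) :
    Sat T (φ.map Sum.inl id) v ↔ Sat (reduct T) φ v :=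
  sat_map T Sum.inl Function.injective_id φ v

theorem expand_reduct {L M : Type} (T : Str (L ⊕ Unit) M) :
    expand (reduct T) (T (Sum.inr ())) = T := by
  funext R
  cases R <;> rfl

theorem vec_eta {M : Type} (v : Fin 2 → M) : ![v 0, v 1] = v := by
  funext i
  fin_cases i <;> rfl

theorem update_one {M : Type} (a b m : M) : Function.update ![a, b] 1 m = ![a, m] := by
  funext i
  fin_cases i <;> rfl

/-- The set of all two-variable formulas satisfied by a valuation. -/
def tp {L M : Type} (S : Str L M) (v : Fin 2 → M) : Set (FO2 L) := {φ | Sat S φ v}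

theorem tp_eq_iff {L M N : Type} {S : Str L M} {T : Str L N} {v : Fin 2 → M} {w : Fin 2 → N} :
    tp S v = tp T w ↔ ∀ φ, Sat S φ v ↔ Sat T φ w :=
  Set.ext_iff

theorem tp_swap {L M N : Type} {S : Str L M} {T : Str L N} {a b : M} {c d : N}
    (h : tp S ![a, b] = tp T ![c, d]) : tp S ![b, a] = tp T ![d, c] := by
  rw [tp_eq_iff] at h ⊢
  intro φ
  have hinj : Function.Injective (![1, 0] : Fin 2 → Fin 2) := by decide
  have key : ∀ {K : Type} (x y : K), ![x, y] ∘ (![1, 0] : Fin 2 → Fin 2) = ![y, x] := by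
    intro K x y
    funext i
    fin_cases i <;> rfl
  have := h (φ.map id ![1, 0])
  rwa [sat_map S id hinj, sat_map T id hinj, key, key] at this

theorem tp_diag {L M N : Type} {S : Str L M} {T : Str L N} {a b : M} {c d : N}
    (h : tp S ![a, b] = tp T ![c, d]) : tp S ![a, a] = tp T ![c, c] := by
  rw [tp_eq_iff] at h ⊢
  intro φ
  simpa [Sat, update_one] using h (.ex 1 (.and (.eq 0 1) φ))

theorem exists_conj {L : Type} (Δ : Finset (FO2 L)) :
    ∃ ψ : FO2 L, ∀ (M : Type) (S : Str L M) (v : Fin 2 → M),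
      Sat S ψ v ↔ ∀ φ ∈ Δ, Sat S φ v := by
  classical
  induction Δ using Finset.induction_on with
  | empty => exact ⟨.eq 0 0, fun M S v => by simp [Sat]⟩
  | insert φ Δ _ ih =>
    obtain ⟨ψ, hψ⟩ := ih
    exact ⟨.and φ ψ, fun M S v => by simp [Sat, hψ]⟩

/-- Every set of two-variable formulas with one element as parameter that is finitely
satisfiable in the structure is realized in it. -/
def IsSaturated2 {L M : Type} (S : Str L M) : Prop :=
  ∀ (i : Fin 2) (v : Fin 2 → M) (Γ : Set (FO2 L)),
    (∀ Δ : Finset (FO2 L), ∃ m, ∀ φ ∈ Δ, φ ∈ Γ → Sat S φ (Function.update v i m)) →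
    ∃ m, ∀ φ ∈ Γ, Sat S φ (Function.update v i m)

theorem IsSaturated2.reduct {L M : Type} {T : Str (L ⊕ Unit) M} (hT : IsSaturated2 T) :
    IsSaturated2 (reduct T) := by
  classical
  intro i v Γ h
  obtain ⟨m, hm⟩ := hT i v ((FOV.map Sum.inl id) '' Γ) (by
    intro Δ
    have : Nonempty (FO2 L) := ⟨.eq 0 0⟩
    choose! g hg using fun ψ (hψ : ψ ∈ (FOV.map Sum.inl (id : Fin 2 → Fin 2)) '' Γ) => hψ
    obtain ⟨m, hm⟩ := h (Δ.image g)
    refine ⟨m, fun φ hφ hφΓ => ?_⟩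
    rw [← (hg φ hφΓ).2, sat_map_inl]
    exact hm _ (Finset.mem_image_of_mem g hφ) (hg φ hφΓ).1)
  exact ⟨m, fun φ hφ => (sat_map_inl T φ _).1 (hm _ ⟨φ, hφ, rfl⟩)⟩

theorem IsSaturated2.exists_tp_update_eq {L M N : Type} {S : Str L M} {T : Str L N}
    (hT : IsSaturated2 T) {v : Fin 2 → M} {w : Fin 2 → N} (h : tp S v = tp T w)
    (i : Fin 2) (m : M) :
    ∃ n, tp S (Function.update v i m) = tp T (Function.update w i n) := by
  classical
  rw [tp_eq_iff] at h
  obtain ⟨n, hn⟩ := hT i w (tp S (Function.update v i m)) (by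
    intro Δ
    obtain ⟨ψ, hψ⟩ := exists_conj (Δ.filter (· ∈ tp S (Function.update v i m)))
    have hv : Sat S (.ex i ψ) v := ⟨m, (hψ _ _ _).2 fun φ hφ => (Finset.mem_filter.1 hφ).2⟩
    obtain ⟨n, hn⟩ := (h _).1 hv
    exact ⟨n, fun φ hφ hφm => (hψ _ _ _).1 hn φ (Finset.mem_filter.2 ⟨hφ, hφm⟩)⟩)
  refine ⟨n, tp_eq_iff.2 fun φ => ⟨hn φ, fun hφ => ?_⟩⟩
  by_contra hc
  exact hn (.not φ) hc hφ

theorem IsSaturated2.isHomog2 {L M : Type} {S : Str L M} (hS : IsSaturated2 S) :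
    IsHomog2 S := by
  intro a b c h
  obtain ⟨d, hd⟩ := hS.exists_tp_update_eq (v := ![a, a]) (w := ![b, b]) h 1 c
  rw [update_one, update_one] at hd
  exact ⟨d, hd⟩

section LimitUltraproduct

variable {X : Type} {M : X → Type}

/-- Equality almost everywhere on a family `F` of sections of `M`. -/
def limSetoid (U : Ultrafilter X) (F : Set (∀ x, M x)) : Setoid F where
  r f g := ∀ᶠ x in U, f.1 x = g.1 x
  iseqv :=
    { refl := fun _ => Filter.Eventually.of_forall fun _ => rfl
      symm := fun h => h.mono fun _ hx => hx.symm
      trans := fun h₁ h₂ => h₁.mp (h₂.mono fun _ hx₂ hx₁ => hx₁.trans hx₂) }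

/-- The limit ultraproduct: sections in `F` modulo equality almost everywhere. -/
abbrev Lim (U : Ultrafilter X) (F : Set (∀ x, M x)) : Type := Quotient (limSetoid U F)

/-- The class of a section in the limit ultraproduct. -/
def Lim.mk (U : Ultrafilter X) {F : Set (∀ x, M x)} (f : F) : Lim U F :=
  Quotient.mk (limSetoid U F) f

theorem Lim.out_mk (U : Ultrafilter X) {F : Set (∀ x, M x)} (f : F) :
    ∀ᶠ x in U, (Lim.mk U f).out.1 x = f.1 x :=
  Quotient.mk_out (s := limSetoid U F) f

/-- The structure on a limit ultraproduct. -/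
def Lim.str {L : Type} (U : Ultrafilter X) (F : Set (∀ x, M x)) (S : ∀ x, Str L (M x)) :
    Str L (Lim U F) :=
  fun R p q => ∀ᶠ x in U, S x R (p.out.1 x) (q.out.1 x)

/-- The family `F` contains witnesses for all existential formulas with parameters in `F`. -/
def WitnessClosed {L : Type} (F : Set (∀ x, M x)) (S : ∀ x, Str L (M x)) : Prop :=
  ∀ (φ : FO2 L) (i : Fin 2) (v : Fin 2 → F), ∃ f : F, ∀ x,
    (∃ m, Sat (S x) φ (Function.update (fun j => (v j).1 x) i m)) →
      Sat (S x) φ (Function.update (fun j => (v j).1 x) i (f.1 x))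

theorem Lim.out_update {U : Ultrafilter X} {F : Set (∀ x, M x)} (v : Fin 2 → Lim U F)
    (i : Fin 2) (m : Lim U F) (x : X) :
    (fun j => (Function.update v i m j).out.1 x) =
      Function.update (fun j => (v j).out.1 x) i (m.out.1 x) := by
  funext j
  by_cases h : j = i
  · subst h
    simp
  · simp [h]

/-- Łoś's theorem for limit ultraproducts. -/
theorem Lim.sat_iff {L : Type} {U : Ultrafilter X} {F : Set (∀ x, M x)}
    {S : ∀ x, Str L (M x)} (hF : WitnessClosed F S) (φ : FO2 L) (v : Fin 2 → Lim U F) :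
    Sat (Lim.str U F S) φ v ↔ ∀ᶠ x in U, Sat (S x) φ (fun j => (v j).out.1 x) := by
  induction φ generalizing v with
  | eq i j =>
    exact (Quotient.out_equiv_out (s := limSetoid U F) (x := v i) (y := v j)).symm
  | rel R i j => rfl
  | not φ ih => exact (not_congr (ih v)).trans Ultrafilter.eventually_not.symm
  | and φ ψ ih₁ ih₂ => exact (and_congr (ih₁ v) (ih₂ v)).trans Filter.eventually_and.symm
  | ex i φ ih =>
    simp only [Sat, ih, Lim.out_update]
    constructor
    · rintro ⟨m, hm⟩
      exact hm.mono fun x hx => ⟨_, hx⟩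
    · intro h
      obtain ⟨f, hf⟩ := hF φ i fun j => (v j).out
      refine ⟨Lim.mk U f, ?_⟩
      filter_upwards [h, Lim.out_mk U f] with x hx hfx
      rw [hfx]
      exact hf x hx

theorem Lim.sat_mk_iff {L : Type} {U : Ultrafilter X} {F : Set (∀ x, M x)}
    {S : ∀ x, Str L (M x)} (hF : WitnessClosed F S) (φ : FO2 L) (f : Fin 2 → F) :
    Sat (Lim.str U F S) φ (fun j => Lim.mk U (f j)) ↔
      ∀ᶠ x in U, Sat (S x) φ (fun j => (f j).1 x) := by
  rw [Lim.sat_iff hF]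
  refine Filter.eventually_congr ?_
  filter_upwards [Filter.eventually_all.2 fun j => Lim.out_mk U (f j)] with x hx
  simp only [hx]

theorem witnessClosed_univ {L : Type} [∀ x, Nonempty (M x)] (S : ∀ x, Str L (M x)) :
    WitnessClosed Set.univ S := by
  intro φ i v
  have : ∀ x, ∃ a, (∃ m, Sat (S x) φ (Function.update (fun j => (v j).1 x) i m)) →
      Sat (S x) φ (Function.update (fun j => (v j).1 x) i a) := by
    intro x
    by_cases h : ∃ m, Sat (S x) φ (Function.update (fun j => (v j).1 x) i m)
    · exact ⟨h.choose, fun _ => h.choose_spec⟩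
    · exact ⟨Classical.arbitrary _, fun h' => absurd h' h⟩
  choose f hf using this
  exact ⟨⟨f, trivial⟩, hf⟩

end LimitUltraproduct

section Saturation

/-- The function `f` on sequences depends only on the first `n` entries. -/
def DependsOnFirst {I A : Type} (n : ℕ) (f : (ℕ → I) → A) : Prop :=
  ∀ x y, (∀ k < n, x k = y k) → f x = f y

theorem DependsOnFirst.mono {I A : Type} {m n : ℕ} {f : (ℕ → I) → A}
    (hf : DependsOnFirst m f) (h : m ≤ n) : DependsOnFirst n f :=
  fun x y hxy => hf x y fun k hk => hxy k (hk.trans_le h)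

theorem DependsOnFirst.update {I A : Type} {m n : ℕ} {f : (ℕ → I) → A}
    (hf : DependsOnFirst m f) (h : m ≤ n) (x : ℕ → I) (i : I) :
    f (Function.update x n i) = f x :=
  hf _ _ fun k hk => Function.update_of_ne (by omega) _ _

/-- Functions on sequences that depend on finitely many entries. -/
def finSupp (I A : Type) : Set ((ℕ → I) → A) := {f | ∃ n, DependsOnFirst n f}

theorem exists_dependsOnFirst {I A : Type} (v : Fin 2 → finSupp I A) :
    ∃ n, DependsOnFirst n fun x j => (v j).1 x := by
  obtain ⟨m, hm⟩ := (v 0).2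
  obtain ⟨n, hn⟩ := (v 1).2
  refine ⟨max m n, fun x y h => ?_⟩
  funext j
  fin_cases j
  · exact hm.mono (le_max_left m n) x y h
  · exact hn.mono (le_max_right m n) x y h

/-- The `n`-fold iterate of an ultrafilter, later entries being quantified first. -/
def iterUltra {I : Type} [Inhabited I] (U : Ultrafilter I) : ℕ → Ultrafilter (ℕ → I)
  | 0 => pure default
  | n + 1 => U.bind fun i => (iterUltra U n).map fun x => Function.update x n i

/-- The limit of the iterates of an ultrafilter. -/
noncomputable def limUltra {I : Type} [Inhabited I] (U : Ultrafilter I) : Ultrafilter (ℕ → I) :=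
  (Filter.hyperfilter ℕ).bind (iterUltra U)

theorem eventually_iterUltra_succ {I : Type} [Inhabited I] (U : Ultrafilter I) (n : ℕ)
    (P : (ℕ → I) → Prop) :
    (∀ᶠ x in iterUltra U (n + 1), P x) ↔
      ∀ᶠ i in U, ∀ᶠ x in iterUltra U n, P (Function.update x n i) :=
  Iff.rfl

theorem eventually_iterUltra_iff {I : Type} [Inhabited I] (U : Ultrafilter I) {n : ℕ}
    {P : (ℕ → I) → Prop} (hP : DependsOnFirst n P) {m : ℕ} (h : n ≤ m) :
    (∀ᶠ x in iterUltra U m, P x) ↔ ∀ᶠ x in iterUltra U n, P x := by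
  induction m, h using Nat.le_induction with
  | base => rfl
  | succ m h ih =>
    rw [eventually_iterUltra_succ, ← ih]
    simp only [hP.update h, Filter.eventually_const]

theorem eventually_limUltra_iff {I : Type} [Inhabited I] (U : Ultrafilter I) {n : ℕ}
    {P : (ℕ → I) → Prop} (hP : DependsOnFirst n P) :
    (∀ᶠ x in limUltra U, P x) ↔ ∀ᶠ x in iterUltra U n, P x := by
  have h : (∀ᶠ x in limUltra U, P x) ↔
      ∀ᶠ m in (Filter.hyperfilter ℕ : Filter ℕ), ∀ᶠ x in iterUltra U m, P x := Iff.rfl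
  have hn : ∀ᶠ m in (Filter.hyperfilter ℕ : Filter ℕ), n ≤ m :=
    (Filter.eventually_ge_atTop n).filter_mono Nat.hyperfilter_le_atTop
  rw [h, Filter.eventually_congr (hn.mono fun m hm => eventually_iterUltra_iff U hP hm),
    Filter.eventually_const]

theorem witnessClosed_finSupp {I L M : Type} [Nonempty M] (S : Str L M) :
    WitnessClosed (finSupp I M) (fun _ => S) := by
  classical
  intro φ i v
  obtain ⟨n, hn⟩ := exists_dependsOnFirst v
  let g : (Fin 2 → M) → M := fun w =>
    if h : ∃ m, Sat S φ (Function.update w i m) then h.choose else Classical.arbitrary M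
  refine ⟨⟨fun x => g fun j => (v j).1 x, n, fun x y h => congrArg g (hn x y h)⟩, ?_⟩
  intro x h
  simp only [g, dif_pos h]
  exact h.choose_spec

/-- An ultrafilter on the finite subsets of `A` containing every cone `{Δ | a ∈ Δ}`. -/
noncomputable def largeUltra (A : Type) : Ultrafilter (Finset A) :=
  haveI := Classical.decEq A
  Ultrafilter.of Filter.atTop

theorem eventually_mem_largeUltra {A : Type} (a : A) : 
    ∀ᶠ Δ in (largeUltra A : Filter (Finset A)), a ∈ Δ := by
  classical
  have h : ∀ᶠ Δ : Finset A in Filter.atTop, a ∈ Δ :=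
    (Filter.eventually_ge_atTop {a}).mono fun Δ hΔ => Finset.singleton_subset_iff.1 hΔ
  exact h.filter_mono (Ultrafilter.of_le _)

theorem isSaturated2_lim {L M : Type} [Nonempty M] (S : Str L M) :
    IsSaturated2 (Lim.str (limUltra (largeUltra (FO2 L))) (finSupp (Finset (FO2 L)) M)
      (fun _ => S)) := by
  classical
  intro i v Γ h
  have hF := witnessClosed_finSupp (I := Finset (FO2 L)) S
  let w : (ℕ → Finset (FO2 L)) → Fin 2 → M := fun x j => (v j).out.1 x
  obtain ⟨n, hn⟩ : ∃ n, DependsOnFirst n w := exists_dependsOnFirst fun j => (v j).out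
  let g : Finset (FO2 L) → (Fin 2 → M) → M := fun Δ u =>
    if h : ∃ m, ∀ φ ∈ Δ, φ ∈ Γ → Sat S φ (Function.update u i m) then h.choose
    else Classical.arbitrary M
  have hg : ∀ Δ, ∀ᶠ x in iterUltra (largeUltra (FO2 L)) n,
      ∀ φ ∈ Δ, φ ∈ Γ → Sat S φ (Function.update (w x) i (g Δ (w x))) := by
    intro Δ
    rw [← eventually_limUltra_iff _ fun x y hxy => by rw [hn x y hxy]]
    obtain ⟨m, hm⟩ := h Δ
    have hx : ∀ᶠ x in limUltra (largeUltra (FO2 L)),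
        ∀ φ ∈ Δ, φ ∈ Γ → Sat S φ (Function.update (w x) i (m.out.1 x)) := by
      rw [Filter.eventually_all_finset]
      intro φ hφ
      by_cases hφΓ : φ ∈ Γ
      · have := (Lim.sat_iff hF φ _).1 (hm φ hφ hφΓ)
        simp only [Lim.out_update] at this
        exact this.mono fun x hx _ => hx
      · exact Filter.Eventually.of_forall fun x hx => absurd hx hφΓ
    filter_upwards [hx] with x hx
    have hex : ∃ m, ∀ φ ∈ Δ, φ ∈ Γ → Sat S φ (Function.update (w x) i m) := ⟨_, hx⟩
    simp only [g, dif_pos hex]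
    exact hex.choose_spec
  have hd : DependsOnFirst (n + 1) fun x => g (x n) (w x) := fun x y hxy => by
    simp only [hn.mono n.le_succ x y hxy, hxy n n.lt_succ_self]
  let d : finSupp (Finset (FO2 L)) M := ⟨fun x => g (x n) (w x), n + 1, hd⟩
  refine ⟨Lim.mk _ d, fun φ hφ => ?_⟩
  rw [Lim.sat_iff hF]
  have key : ∀ᶠ x in limUltra (largeUltra (FO2 L)),
      Sat S φ (Function.update (w x) i (g (x n) (w x))) := by
    rw [eventually_limUltra_iff (n := n + 1) _ fun x y hxy => by
      rw [hn.mono n.le_succ x y hxy, hxy n n.lt_succ_self], eventually_iterUltra_succ]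
    filter_upwards [eventually_mem_largeUltra φ] with Δ hΔ
    filter_upwards [hg Δ] with x hx
    rw [hn.update le_rfl, Function.update_self]
    exact hx φ hΔ hφ
  filter_upwards [key, Lim.out_mk (limUltra (largeUltra (FO2 L))) d] with x hx hdx
  rw [Lim.out_update, hdx]
  exact hx

/-- Every structure has a saturated elementary extension with respect to
two-variable formulas. -/
theorem exists_saturated_extension {L M : Type} [Nonempty M] (S : Str L M) :
    ∃ (N : Type) (T : Str L N) (e : M → N), IsSaturated2 T ∧
      (∀ φ (v : Fin 2 → M), Sat T φ (fun j => e (v j)) ↔ Sat S φ v) ∧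
      ∀ φ : FO2 L, (∀ v, Sat S φ v) → ∀ v, Sat T φ v := by
  have hF := witnessClosed_finSupp (I := Finset (FO2 L)) S
  refine ⟨_, _, fun m => Lim.mk _ (F := finSupp (Finset (FO2 L)) M)
    ⟨fun _ => m, 0, fun _ _ _ => rfl⟩, isSaturated2_lim S, ?_, ?_⟩
  · intro φ v
    refine (Lim.sat_mk_iff hF φ _).trans ?_
    simp only [Filter.eventually_const]
  · intro φ h v
    exact (Lim.sat_iff hF φ v).2 (Filter.Eventually.of_forall fun x => h _)

end Saturation

/-- Relations that do not cut types transfer along equality of types between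
saturated structures. -/
theorem sat_expand_iff {L M N : Type} {S : Str L M} {T : Str L N} (hS : IsSaturated2 S)
    (hT : IsSaturated2 T) {R : M → M → Prop} {Q : N → N → Prop}
    (hRQ : ∀ a b c d, tp S ![a, b] = tp T ![c, d] → (R a b ↔ Q c d))
    (φ : FO2 (L ⊕ Unit)) (v : Fin 2 → M) (w : Fin 2 → N) (h : tp S v = tp T w) :
    Sat (expand S R) φ v ↔ Sat (expand T Q) φ w := by
  induction φ generalizing v w with
  | eq i j => exact tp_eq_iff.1 h (.eq i j)
  | rel r i j =>
    rcases r with r | r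
    · exact tp_eq_iff.1 h (.rel r i j)
    · have h01 : tp S ![v 0, v 1] = tp T ![w 0, w 1] := by rwa [vec_eta, vec_eta]
      have h10 := tp_swap h01
      fin_cases i <;> fin_cases j
      · exact hRQ _ _ _ _ (tp_diag h01)
      · exact hRQ _ _ _ _ h01
      · exact hRQ _ _ _ _ h10
      · exact hRQ _ _ _ _ (tp_diag h10)
  | not φ ih => exact not_congr (ih v w h)
  | and φ ψ ih₁ ih₂ => exact and_congr (ih₁ v w h) (ih₂ v w h)
  | ex i φ ih =>
    constructor
    · rintro ⟨m, hm⟩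
      obtain ⟨n, hn⟩ := hT.exists_tp_update_eq h i m
      exact ⟨n, (ih _ _ hn).1 hm⟩
    · rintro ⟨n, hn⟩
      obtain ⟨m, hm⟩ := hS.exists_tp_update_eq h.symm i n
      exact ⟨m, (ih _ _ hm.symm).2 hn⟩

/-- A model of `Th ∪ Sg` with a pair of elements. -/
structure PointedModel (L : Type) (Th : Set (FO2 L)) (Sg : Set (FO2 (L ⊕ Unit))) where
  carrier : Type
  str : Str (L ⊕ Unit) carrier
  point : Fin 2 → carrier
  modelsTh : ModelsSet (reduct str) Th
  modelsSg : ModelsSet str Sg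

/-- The new relation holds at the distinguished pair. -/
def PointedModel.Holds {L : Type} {Th : Set (FO2 L)} {Sg : Set (FO2 (L ⊕ Unit))}
    (z : PointedModel L Th Sg) : Prop :=
  Sat z.str (.rel (Sum.inr ()) 0 1) z.point

/-- The `L`-type of the distinguished pair. -/
def PointedModel.type {L : Type} {Th : Set (FO2 L)} {Sg : Set (FO2 (L ⊕ Unit))}
    (z : PointedModel L Th Sg) : Set (FO2 L) :=
  tp (reduct z.str) z.point

theorem PointedModel.exists_saturated {L : Type} {Th : Set (FO2 L)}
    {Sg : Set (FO2 (L ⊕ Unit))} (z : PointedModel L Th Sg) :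
    ∃ z' : PointedModel L Th Sg, IsSaturated2 (reduct z'.str) ∧ z'.type = z.type ∧
      (z'.Holds ↔ z.Holds) := by
  have : Nonempty z.carrier := ⟨z.point 0⟩
  obtain ⟨N, T, e, hsat, he, hmod⟩ := exists_saturated_extension z.str
  refine ⟨⟨N, T, fun j => e (z.point j), fun φ hφ v => ?_, fun φ hφ => hmod φ (z.modelsSg φ hφ)⟩,
    hsat.reduct, tp_eq_iff.2 fun φ => ?_, he _ _⟩
  · rw [← sat_map_inl]
    exact hmod _ (fun u => (sat_map_inl _ _ _).2 (z.modelsTh φ hφ u)) v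
  · rw [← sat_map_inl, ← sat_map_inl]
    exact he _ _

/-- Under the no-cut condition for 2-homogeneous models, the `L`-type of a pair decides
the implicitly defined relation, across all models. -/
theorem holds_iff_of_type_eq {L : Type} {Th : Set (FO2 L)} {Sg : Set (FO2 (L ⊕ Unit))}
    (hweak : WeakImplicitDef L Th Sg)
    (hcut : ∀ (M : Type) (S : Str L M), Nonempty M → IsHomog2 S → ModelsSet S Th →
      ∀ R : M → M → Prop, ModelsSet (expand S R) Sg → NoCut S R)
    (z z' : PointedModel L Th Sg) (h : z.type = z'.type) : z.Holds ↔ z'.Holds := by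
  obtain ⟨y, hy, hyz, hyh⟩ := z.exists_saturated
  obtain ⟨y', hy', hyz', hyh'⟩ := z'.exists_saturated
  rw [← hyh, ← hyh']
  have htp : y.type = y'.type := hyz.trans (h.trans hyz'.symm)
  have hSg : ModelsSet (expand (reduct y.str) (y.str (Sum.inr ()))) Sg := by
    rw [expand_reduct]
    exact y.modelsSg
  have hSg' : ModelsSet (expand (reduct y'.str) (y'.str (Sum.inr ()))) Sg := by
    rw [expand_reduct]
    exact y'.modelsSg
  have hnocut : NoCut (reduct y'.str) (y'.str (Sum.inr ())) :=
    hcut _ _ ⟨y'.point 0⟩ hy'.isHomog2 y'.modelsTh _ hSg'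
  let R : y.carrier → y.carrier → Prop := fun a b =>
    ∃ c d, tp (reduct y.str) ![a, b] = tp (reduct y'.str) ![c, d] ∧ y'.str (Sum.inr ()) c d
  have hR : ∀ a b c d, tp (reduct y.str) ![a, b] = tp (reduct y'.str) ![c, d] →
      (R a b ↔ y'.str (Sum.inr ()) c d) := by
    intro a b c d hab
    refine ⟨?_, fun hcd => ⟨c, d, hab, hcd⟩⟩
    rintro ⟨c', d', hab', hcd'⟩
    exact (hnocut _ _ _ _ (hab'.symm.trans hab)).1 hcd'
  have hRSg : ModelsSet (expand (reduct y.str) R) Sg := by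
    intro φ hφ v
    obtain ⟨c, hc⟩ := hy'.exists_tp_update_eq htp 0 (v 0)
    obtain ⟨d, hd⟩ := hy'.exists_tp_update_eq hc 1 (v 1)
    have hv : Function.update (Function.update y.point 0 (v 0)) 1 (v 1) = v := by
      funext i
      fin_cases i <;> rfl
    rw [hv] at hd
    exact (sat_expand_iff hy hy' hR φ v _ hd).2 (hSg' φ hφ _)
  have heq := hweak _ _ ⟨y.point 0⟩ y.modelsTh _ _ hSg hRSg
  have hp := hR (y.point 0) (y.point 1) (y'.point 0) (y'.point 1) (by
    rw [vec_eta, vec_eta]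
    exact htp)
  rw [← heq] at hp
  exact hp

/-- Two classes of pointed models no members of which agree on a finite set of formulas
are separated by a formula. -/
theorem exists_separating {L : Type} {Th : Set (FO2 L)} {Sg : Set (FO2 (L ⊕ Unit))}
    (Δ : Finset (FO2 L)) (P Q : PointedModel L Th Sg → Prop)
    (h : ∀ z z', P z → Q z' → ¬ ∀ φ ∈ Δ, φ ∈ z.type ↔ φ ∈ z'.type) :
    ∃ φ : FO2 L, (∀ z, P z → φ ∈ z.type) ∧ ∀ z, Q z → φ ∉ z.type := by
  classical
  induction Δ using Finset.induction_on generalizing P Q with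
  | empty =>
    by_cases hP : ∃ z, P z
    · obtain ⟨z, hz⟩ := hP
      exact ⟨.eq 0 0, fun _ _ => rfl, fun z' hz' => absurd (by simp) (h z z' hz hz')⟩
    · exact ⟨.not (.eq 0 0), fun z hz => absurd ⟨z, hz⟩ hP, fun z _ hc => hc rfl⟩
  | insert ψ Δ _ ih =>
    obtain ⟨φ₁, hP₁, hQ₁⟩ := ih (fun z => P z ∧ ψ ∈ z.type) (fun z => Q z ∧ ψ ∈ z.type)
      fun z z' hz hz' hag => h z z' hz.1 hz'.1 (by simpa [hz.2, hz'.2] using hag)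
    obtain ⟨φ₂, hP₂, hQ₂⟩ := ih (fun z => P z ∧ ψ ∉ z.type) (fun z => Q z ∧ ψ ∉ z.type)
      fun z z' hz hz' hag => h z z' hz.1 hz'.1 (by simpa [hz.2, hz'.2] using hag)
    have hmem : ∀ z : PointedModel L Th Sg,
        FOV.and (.not (.and ψ (.not φ₁))) (.not (.and (.not ψ) (.not φ₂))) ∈ z.type ↔
          ¬(ψ ∈ z.type ∧ φ₁ ∉ z.type) ∧ ¬(ψ ∉ z.type ∧ φ₂ ∉ z.type) := fun _ => Iff.rfl
    refine ⟨.and (.not (.and ψ (.not φ₁))) (.not (.and (.not ψ) (.not φ₂))),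
      fun z hz => ?_, fun z hz => ?_⟩
    · rw [hmem]
      exact ⟨fun hc => hc.2 (hP₁ z ⟨hz, hc.1⟩), fun hc => hc.2 (hP₂ z ⟨hz, hc.1⟩)⟩
    · rw [hmem]
      rintro ⟨h₁, h₂⟩
      by_cases hψ : ψ ∈ z.type
      · exact h₁ ⟨hψ, hQ₁ z ⟨hz, hψ⟩⟩
      · exact h₂ ⟨hψ, hQ₂ z ⟨hz, hψ⟩⟩

/-- The ultraproduct of a family of pointed models. -/
theorem exists_ultraproduct {L : Type} {Th : Set (FO2 L)} {Sg : Set (FO2 (L ⊕ Unit))}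
    {X : Type} (U : Ultrafilter X) (z : X → PointedModel L Th Sg) :
    ∃ y : PointedModel L Th Sg, (∀ φ, φ ∈ y.type ↔ ∀ᶠ x in U, φ ∈ (z x).type) ∧
      (y.Holds ↔ ∀ᶠ x in U, (z x).Holds) := by
  have : ∀ x, Nonempty (z x).carrier := fun x => ⟨(z x).point 0⟩
  have hF := witnessClosed_univ fun x => (z x).str
  have hF' := witnessClosed_univ fun x => reduct (z x).str
  refine ⟨⟨Lim U Set.univ, Lim.str U Set.univ fun x => (z x).str,
    fun j => Lim.mk U ⟨fun x => (z x).point j, trivial⟩, fun φ hφ v => ?_, fun φ hφ v => ?_⟩,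
    fun φ => Lim.sat_mk_iff hF' φ _, Lim.sat_mk_iff hF _ _⟩
  · exact (Lim.sat_iff hF' φ v).2 (Filter.Eventually.of_forall fun x => (z x).modelsTh φ hφ _)
  · exact (Lim.sat_iff hF φ v).2 (Filter.Eventually.of_forall fun x => (z x).modelsSg φ hφ _)

theorem madeExplicit_of_noCut_homog {L : Type} {Th : Set (FO2 L)}
    {Sg : Set (FO2 (L ⊕ Unit))} (hweak : WeakImplicitDef L Th Sg)
    (hcut : ∀ (M : Type) (S : Str L M), Nonempty M → IsHomog2 S → ModelsSet S Th →
      ∀ R : M → M → Prop, ModelsSet (expand S R) Sg → NoCut S R) :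
    MadeExplicit L Th Sg := by
  by_cases hsep : ∃ φ : FO2 L, (∀ z : PointedModel L Th Sg, z.Holds → φ ∈ z.type) ∧
      ∀ z : PointedModel L Th Sg, ¬ z.Holds → φ ∉ z.type
  · obtain ⟨φ, h₁, h₂⟩ := hsep
    refine ⟨φ, fun M S _ hTh R hSg a b => ?_⟩
    let z : PointedModel L Th Sg := ⟨M, expand S R, ![a, b], hTh, hSg⟩
    exact ⟨h₁ z, fun hφ => by_contra fun hR => h₂ z hR hφ⟩
  · have hΔ : ∀ Δ : Finset (FO2 L), ∃ z z' : PointedModel L Th Sg, z.Holds ∧ ¬ z'.Holds ∧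
        ∀ φ ∈ Δ, φ ∈ z.type ↔ φ ∈ z'.type := by
      intro Δ
      by_contra hc
      exact hsep (exists_separating Δ _ _ fun z z' hz hz' hag => hc ⟨z, z', hz, hz', hag⟩)
    choose z z' hz hz' hag using hΔ
    obtain ⟨y, hy, hyh⟩ := exists_ultraproduct (largeUltra (FO2 L)) z
    obtain ⟨y', hy', hyh'⟩ := exists_ultraproduct (largeUltra (FO2 L)) z'
    have htype : y.type = y'.type := by
      ext φ
      rw [hy, hy']
      exact Filter.eventually_congr
        ((eventually_mem_largeUltra φ).mono fun Δ hφ => hag Δ φ hφ)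
    have hiff := holds_iff_of_type_eq hweak hcut y y' htype
    rw [hyh, hyh'] at hiff
    obtain ⟨Δ, hΔ⟩ := (hiff.1 (Filter.Eventually.of_forall hz)).exists
    exact absurd hΔ (hz' Δ)

/-- Cut lemma: for a weak implicit definition Σ of R w.r.t. Th,
the following are equivalent: (i) Σ can be made explicit by an FO2(L)-formula;
(ii) R never cuts 2-types in models of Th ∪ Σ; (iii) R never cuts 2-types in
2-homogeneous models of Th ∪ Σ. -/
theorem stmt6 (L : Type) (Th : Set (FO2 L)) (Sg : Set (FO2 (L ⊕ Unit)))
    (hTh : ∀ φ ∈ Th, Sentence φ) (hSg : ∀ φ ∈ Sg, Sentence φ)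
    (hweak : WeakImplicitDef L Th Sg) :
    (MadeExplicit L Th Sg ↔
      (∀ (M : Type) (S : Str L M), Nonempty M → ModelsSet S Th →
        ∀ R : M → M → Prop, ModelsSet (expand S R) Sg → NoCut S R)) ∧
    ((∀ (M : Type) (S : Str L M), Nonempty M → ModelsSet S Th →
        ∀ R : M → M → Prop, ModelsSet (expand S R) Sg → NoCut S R) ↔
      (∀ (M : Type) (S : Str L M), Nonempty M → IsHomog2 S → ModelsSet S Th →
        ∀ R : M → M → Prop, ModelsSet (expand S R) Sg → NoCut S R)) := by
  have himp : MadeExplicit L Th Sg →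
      ∀ (M : Type) (S : Str L M), Nonempty M → ModelsSet S Th →
        ∀ R : M → M → Prop, ModelsSet (expand S R) Sg → NoCut S R := by
    rintro ⟨φ, hφ⟩ M S hM hS R hR a b c d h
    rw [hφ M S hM hS R hR a b, hφ M S hM hS R hR c d]
    exact Set.ext_iff.1 h φ
  exact ⟨⟨himp, fun h => madeExplicit_of_noCut_homog hweak fun M S hM _ => h M S hM⟩,
    fun h M S hM _ => h M S hM, fun h => himp (madeExplicit_of_noCut_homog hweak h)⟩

end AN
end

section
/- Let L be a binary relational language and let M and N be L-structures. If there is a 2-isomorphism between M and N and N is 2-homogeneous, then M is 2-homogeneous. -/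
namespace AN

/-- A 2-isomorphism relating two elements also relates the corresponding diagonal pairs. -/
theorem IsTwoIso.diag {L M N : Type} {S : Str L M} {T : Str L N}
    {i1 : M → N → Prop} {i2 : M → M → N → N → Prop} (h : IsTwoIso S T i1 i2)
    {a : M} {a' : N} (ha : i1 a a') : i2 a a a' a' := by
  obtain ⟨b', hb⟩ := h.forth2 a a' ha a
  obtain rfl := (h.eq_iff _ _ _ _ hb).1 rfl
  exact hb

/-- Valuations related by a 2-isomorphism, in either order of the variables, satisfy the same
two-variable formulas. -/
theorem IsTwoIso.sat_iff_s10 {L M N : Type} {S : Str L M} {T : Str L N}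
    {i1 : M → N → Prop} {i2 : M → M → N → N → Prop} (h : IsTwoIso S T i1 i2) (φ : FO2 L)
    (v : Fin 2 → M) (w : Fin 2 → N)
    (hvw : i2 (v 0) (v 1) (w 0) (w 1) ∨ i2 (v 1) (v 0) (w 1) (w 0)) :
    Sat S φ v ↔ Sat T φ w := by
  induction φ generalizing v w with
  | eq i j =>
    have key : v 0 = v 1 ↔ w 0 = w 1 := by
      rcases hvw with hvw | hvw
      · exact h.eq_iff _ _ _ _ hvw
      · rw [eq_comm, h.eq_iff _ _ _ _ hvw, eq_comm]
    have key' : v 1 = v 0 ↔ w 1 = w 0 := by rw [eq_comm, key, eq_comm]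
    fin_cases i <;> fin_cases j <;> simp [Sat, key, key']
  | rel r i j =>
    rcases hvw with hvw | hvw <;>
      obtain ⟨h₁, h₂, h₃, h₄⟩ := h.rel_iff2 _ _ _ _ hvw r <;>
      fin_cases i <;> fin_cases j <;> simp [Sat, h₁, h₂, h₃, h₄]
  | not φ ih => exact not_congr (ih v w hvw)
  | and φ ψ ih₁ ih₂ => exact and_congr (ih₁ v w hvw) (ih₂ v w hvw)
  | ex i φ ih =>
    have h01 : i1 (v 0) (w 0) ∧ i1 (v 1) (w 1) := by
      rcases hvw with hvw | hvw
      · exact h.restrict _ _ _ _ hvw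
      · exact (h.restrict _ _ _ _ hvw).symm
    fin_cases i
    · constructor
      · rintro ⟨m, hm⟩
        obtain ⟨m', hm'⟩ := h.forth2 _ _ h01.2 m
        exact ⟨m', (ih _ _ (Or.inr (by simpa using hm'))).1 hm⟩
      · rintro ⟨m', hm'⟩
        obtain ⟨m, hm⟩ := h.back2 _ _ h01.2 m'
        exact ⟨m, (ih _ _ (Or.inr (by simpa using hm))).2 hm'⟩
    · constructor
      · rintro ⟨m, hm⟩
        obtain ⟨m', hm'⟩ := h.forth2 _ _ h01.1 m
        exact ⟨m', (ih _ _ (Or.inl (by simpa using hm'))).1 hm⟩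
      · rintro ⟨m', hm'⟩
        obtain ⟨m, hm⟩ := h.back2 _ _ h01.1 m'
        exact ⟨m, (ih _ _ (Or.inl (by simpa using hm))).2 hm'⟩

/-- Pairs related by a 2-isomorphism have the same 2-type. -/
theorem IsTwoIso.type2_eq {L M N : Type} {S : Str L M} {T : Str L N}
    {i1 : M → N → Prop} {i2 : M → M → N → N → Prop} (h : IsTwoIso S T i1 i2)
    {a b : M} {a' b' : N} (hab : i2 a b a' b') : Type2 S a b = Type2 T a' b' :=
  Set.ext fun φ => h.sat_iff_s10 φ ![a, b] ![a', b'] (Or.inl hab)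

/-- 2-isomorphisms preserve 2-homogeneity: if there is a
2-isomorphism between M and N and N is 2-homogeneous, then so is M. -/
theorem stmt10 (L M N : Type) (S : Str L M) (T : Str L N)
    (i1 : M → N → Prop) (i2 : M → M → N → N → Prop)
    (h : IsTwoIso S T i1 i2) (hT : IsHomog2 T) :
    IsHomog2 S := by
  intro a b c hab
  obtain ⟨a', ha⟩ := h.forth1 a
  obtain ⟨b', hb⟩ := h.forth1 b
  obtain ⟨c', hc⟩ := h.forth2 a a' ha c
  rw [h.type2_eq (h.diag ha), h.type2_eq (h.diag hb)] at hab
  obtain ⟨d', hd'⟩ := hT a' b' c' hab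
  obtain ⟨d, hd⟩ := h.back2 b b' hb d'
  exact ⟨d, by rw [h.type2_eq hc, hd', h.type2_eq hd]⟩

end AN
end

section
/- Let L be a binary relational language. Every finite L-structure is 2-homogeneous. -/
namespace AN

/-- Every finite family of formulas has a conjunction. -/
theorem exists_sat_iff_forall_mem {L V M ι : Type} [DecidableEq V] [Nonempty V] (S : Str L M)
    (φ : ι → FOV L V) (s : Finset ι) :
    ∃ ψ : FOV L V, ∀ v : V → M, Sat S ψ v ↔ ∀ i ∈ s, Sat S (φ i) v := by
  classical
  induction s using Finset.induction_on with
  | empty =>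
    obtain ⟨x⟩ := ‹Nonempty V›
    exact ⟨.eq x x, fun v => by simp [Sat]⟩
  | insert i s _ ih =>
    obtain ⟨ψ, hψ⟩ := ih
    exact ⟨.and (φ i) ψ, fun v => by simp [Sat, hψ]⟩

/-- A strict inclusion between 2-types is impossible. -/
theorem Type2_eq_of_subset {L M : Type} {S : Str L M} {a b c d : M}
    (h : Type2 S a b ⊆ Type2 S c d) : Type2 S a b = Type2 S c d := by
  refine h.antisymm fun φ hφ => ?_
  by_contra hn
  exact h (show FOV.not φ ∈ Type2 S a b from hn) hφ

theorem sat2_ex_one {L M : Type} (S : Str L M) (φ : FO2 L) (a b : M) :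
    Sat2 S (.ex 1 φ) a b ↔ ∃ d, Sat2 S φ a d := by
  have h (d : M) : Function.update ![a, b] 1 d = ![a, d] := by
    ext i; fin_cases i <;> simp
  simp only [Sat2, Sat, h]

/-- Every finite structure is 2-homogeneous. -/
theorem stmt11 (L M : Type) [Finite M] (S : Str L M) :
    IsHomog2 S := by
  intro a b c hab
  by_contra! hne
  have hsep (d : M) : ∃ φ, Sat2 S φ a c ∧ ¬ Sat2 S φ b d :=
    Set.not_subset.mp fun h => hne d (Type2_eq_of_subset h)
  choose φ hac hbd using hsep
  have := Fintype.ofFinite M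
  obtain ⟨ψ, hψ⟩ := exists_sat_iff_forall_mem S φ Finset.univ
  have ha : FOV.ex 1 ψ ∈ Type2 S a a :=
    (sat2_ex_one S ψ a a).mpr ⟨c, (hψ _).mpr fun d _ => hac d⟩
  rw [hab] at ha
  obtain ⟨d, hd⟩ := (sat2_ex_one S ψ b b).mp ha
  exact hbd d ((hψ _).mp hd d (Finset.mem_univ d))

end AN
end

section
/- Let L be a binary relational language, R a binary relation symbol not in L, and let Th ⊆ FO2(L) and Σ ⊆ FO2(L ∪ {R}) be sets of sentences such that Σ is a weak implicit definition of R with respect to Th. Then Σ can be made explicit with respect to Th by an FO2(L)-formula if and only if there exists a 2-partition ⟨π_i : i ≤ n⟩ (with respect to Th ∪ Σ) such that R cannot cut π_i for any i ≤ n. -/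
namespace AN

/-- FO2-formulas are closed under finite disjunctions. -/
theorem exists_sat2_iff_exists_mem {L ι : Type} (π : ι → FO2 L) (s : Finset ι) :
    ∃ φ : FO2 L, ∀ (M : Type) (S : Str L M) (a b : M),
      Sat2 S φ a b ↔ ∃ i ∈ s, Sat2 S (π i) a b := by
  classical
  induction s using Finset.induction_on with
  | empty => exact ⟨.not (.eq 0 0), fun M S a b => by simp [Sat2, Sat]⟩
  | insert i s _ ih =>
    obtain ⟨φ, hφ⟩ := ih
    refine ⟨.not (.and (.not (π i)) (.not φ)), fun M S a b => ?_⟩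
    rw [Finset.exists_mem_insert, ← hφ M S a b]
    simp only [Sat2, Sat]
    tauto

/-- A weak implicit definition Σ can be made explicit w.r.t. Th
iff there is a 2-partition into which R cannot cut. -/
theorem stmt12 (L : Type) (Th : Set (FO2 L)) (Sg : Set (FO2 (L ⊕ Unit)))
    (hTh : ∀ φ ∈ Th, Sentence φ) (hSg : ∀ φ ∈ Sg, Sentence φ)
    (hweak : WeakImplicitDef L Th Sg) :
    MadeExplicit L Th Sg ↔
      ∃ (n : ℕ) (π : Fin (n + 1) → FO2 L),
        IsTwoPartition L Th Sg π ∧ ∀ i, CannotCut L Th Sg (π i) := by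
  classical
  constructor
  · rintro ⟨φ, hφ⟩
    refine ⟨1, ![φ, .not φ], fun M S hM hS R hR => ⟨fun a b => ?_, fun a b => ?_⟩, ?_⟩
    · by_cases h : Sat2 S φ a b
      · exact ⟨0, h⟩
      · exact ⟨1, h⟩
    · rw [Fin.forall_fin_two]
      refine ⟨Fin.forall_fin_two.2 ⟨by simp, fun _ h => h.2 h.1⟩,
        Fin.forall_fin_two.2 ⟨by simp, by simp⟩⟩
    · refine Fin.forall_fin_two.2 ⟨Or.inl ?_, Or.inr ?_⟩
      · exact fun M S hM hS R hR a b h => (hφ M S hM hS R hR a b).2 h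
      · exact fun M S hM hS R hR a b h h' => h ((hφ M S hM hS R hR a b).1 h')
  · rintro ⟨n, π, hπ, hcut⟩
    obtain ⟨φ, hφ⟩ := exists_sat2_iff_exists_mem π
      (Finset.univ.filter fun i => ∀ (M : Type) (S : Str L M), Nonempty M → ModelsSet S Th →
        ∀ R : M → M → Prop, ModelsSet (expand S R) Sg → ∀ a b : M, Sat2 S (π i) a b → R a b)
    refine ⟨φ, fun M S hM hS R hR a b => ?_⟩
    rw [hφ]
    constructor
    · intro h
      obtain ⟨i, hi⟩ := (hπ M S hM hS R hR).1 a b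
      refine ⟨i, Finset.mem_filter.2 ⟨Finset.mem_univ i, ?_⟩, hi⟩
      exact (hcut i).resolve_right fun hneg => hneg M S hM hS R hR a b hi h
    · rintro ⟨i, hi, h⟩
      exact (Finset.mem_filter.1 hi).2 M S hM hS R hR a b h

end AN
end

section
/- Let L be a binary relational language, R a binary relation symbol not in L, and let Th ⊆ FO2(L) and Σ ⊆ FO2(L ∪ {R}) be sets of sentences such that Σ is a weak implicit definition of R with respect to Th. If Σ cannot be made explicit with respect to Th by any FO2(L)-formula, then there exists a complete 2-type T ⊆ FO2(L) (i.e., for every φ(x,y) ∈ FO2(L), either φ ∈ T or ¬φ ∈ T) such that there are a model (M,R) of Th ∪ Σ and elements a, b, c, d ∈ M with R(a,b), not R(c,d), and Type(a,b,M) = T = Type(c,d,M); that is, R cuts the 2-type T in M. -/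
namespace AN

/-- The ultraproduct of a family of types. -/
abbrev Ultraproduct {I : Type} (U : Ultrafilter I) (M : I → Type) : Type :=
  Quotient ((U : Filter I).productSetoid M)

/-- The ultraproduct of a family of binary relations. -/
def ultraRel {I : Type} (U : Ultrafilter I) {M : I → Type} (R : ∀ i, M i → M i → Prop)
    (a b : Ultraproduct U M) : Prop :=
  ∀ᶠ i in (U : Filter I), R i (a.out i) (b.out i)

theorem ultraRel_mk {I : Type} (U : Ultrafilter I) {M : I → Type} (R : ∀ i, M i → M i → Prop)
    (f g : ∀ i, M i) :
    ultraRel U R (Quotient.mk _ f) (Quotient.mk _ g) ↔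
      ∀ᶠ i in (U : Filter I), R i (f i) (g i) := by
  have hf : ∀ᶠ i in (U : Filter I),
      (Quotient.mk ((U : Filter I).productSetoid M) f).out i = f i :=
    Quotient.mk_out (s := (U : Filter I).productSetoid M) f
  have hg : ∀ᶠ i in (U : Filter I),
      (Quotient.mk ((U : Filter I).productSetoid M) g).out i = g i :=
    Quotient.mk_out (s := (U : Filter I).productSetoid M) g
  refine Filter.eventually_congr ?_
  filter_upwards [hf, hg] with i h₁ h₂
  rw [h₁, h₂]

/-- The ultraproduct of a family of structures. -/
def ultraStr {I L : Type} (U : Ultrafilter I) {M : I → Type} (S : ∀ i, Str L (M i)) :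
    Str L (Ultraproduct U M) :=
  fun r => ultraRel U fun i => S i r

/-- The theorem of Łoś. -/
theorem sat_ultraStr {I L V : Type} [DecidableEq V] (U : Ultrafilter I) {M : I → Type}
    (S : ∀ i, Str L (M i)) (φ : FOV L V) (v : V → ∀ i, M i) :
    Sat (ultraStr U S) φ (fun x => Quotient.mk _ (v x)) ↔
      ∀ᶠ i in (U : Filter I), Sat (S i) φ (fun x => v x i) := by
  induction φ generalizing v with
  | eq x y =>
    exact Quotient.eq (r := (U : Filter I).productSetoid M)
  | rel r x y => exact ultraRel_mk U _ _ _
  | not φ ih =>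
    simp only [Sat, ih]
    exact Ultrafilter.eventually_not.symm
  | and φ ψ ih₁ ih₂ =>
    simp only [Sat, ih₁, ih₂]
    exact Filter.eventually_and.symm
  | ex x φ ih =>
    have update_mk : ∀ f : ∀ i, M i,
        Function.update (fun y => (Quotient.mk _ (v y) : Ultraproduct U M)) x
          (Quotient.mk _ f) = fun y => Quotient.mk _ (Function.update v x f y) := by
      intro f
      funext y
      by_cases h : y = x
      · subst h; simp
      · simp [h]
    have update_apply : ∀ (f : ∀ i, M i) (i : I),
        (fun y => Function.update v x f y i) = Function.update (fun y => v y i) x (f i) := by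
      intro f i
      funext y
      by_cases h : y = x
      · subst h; simp
      · simp [h]
    simp only [Sat]
    constructor
    · rintro ⟨m, hm⟩
      induction m using Quotient.inductionOn with
      | h f =>
        rw [update_mk, ih] at hm
        filter_upwards [hm] with i hi
        exact ⟨f i, by rwa [update_apply] at hi⟩
    · intro h
      classical
      let f : ∀ i, M i := fun i =>
        if h : ∃ m, Sat (S i) φ (Function.update (fun y => v y i) x m) then h.choose else v x i
      refine ⟨Quotient.mk _ f, ?_⟩
      rw [update_mk, ih]
      filter_upwards [h] with i hi
      rw [update_apply]
      simp only [f, dif_pos hi]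
      exact hi.choose_spec

theorem sat2_ultraStr {I L : Type} (U : Ultrafilter I) {M : I → Type}
    (S : ∀ i, Str L (M i)) (φ : FO2 L) (a b : ∀ i, M i) :
    Sat2 (ultraStr U S) φ (Quotient.mk _ a) (Quotient.mk _ b) ↔
      ∀ᶠ i in (U : Filter I), Sat2 (S i) φ (a i) (b i) := by
  have h := sat_ultraStr U S φ ![a, b]
  have h₁ : (fun x => (Quotient.mk _ (![a, b] x) : Ultraproduct U M)) =
      ![Quotient.mk _ a, Quotient.mk _ b] := by
    funext x; fin_cases x <;> rfl
  have h₂ : ∀ i, (fun x => (![a, b] : Fin 2 → ∀ i, M i) x i) = ![a i, b i] := by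
    intro i; funext x; fin_cases x <;> rfl
  simpa only [h₁, h₂, Sat2] using h

theorem modelsSet_ultraStr {I L V : Type} [DecidableEq V] (U : Ultrafilter I) {M : I → Type}
    (S : ∀ i, Str L (M i)) {Th : Set (FOV L V)} (h : ∀ i, ModelsSet (S i) Th) :
    ModelsSet (ultraStr U S) Th := by
  intro φ hφ v
  have hv : v = fun x => Quotient.mk _ ((v x).out) := by
    funext x; exact (Quotient.out_eq _).symm
  rw [hv, sat_ultraStr]
  exact Filter.Eventually.of_forall fun i => h i φ hφ _

theorem expand_ultraStr {I L : Type} (U : Ultrafilter I) {M : I → Type}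
    (S : ∀ i, Str L (M i)) (R : ∀ i, M i → M i → Prop) :
    expand (ultraStr U S) (ultraRel U R) = ultraStr U fun i => expand (S i) (R i) := by
  funext r
  cases r <;> rfl

/-- A property that depends only on finitely many formulas is defined by a formula. -/
theorem exists_formula_of_finset {L : Type} {P : Type*} (holds : P → FO2 L → Prop)
    (holds_eq : ∀ p, holds p (.eq 0 0))
    (holds_not : ∀ p φ, holds p (.not φ) ↔ ¬ holds p φ)
    (holds_and : ∀ p φ ψ, holds p (.and φ ψ) ↔ holds p φ ∧ holds p ψ)
    (F : Finset (FO2 L)) (Q : P → Prop)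
    (hQ : ∀ p q, (∀ φ ∈ F, holds p φ ↔ holds q φ) → Q p → Q q) :
    ∃ φ : FO2 L, ∀ p, Q p ↔ holds p φ := by
  classical
  induction F using Finset.induction_on generalizing Q with
  | empty =>
    by_cases h : ∃ p, Q p
    · obtain ⟨p, hp⟩ := h
      exact ⟨.eq 0 0, fun q => ⟨fun _ => holds_eq q, fun _ => hQ p q (by simp) hp⟩⟩
    · exact ⟨.not (.eq 0 0), fun q =>
        ⟨fun hq => (h ⟨q, hq⟩).elim, fun hq => ((holds_not _ _).1 hq (holds_eq q)).elim⟩⟩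
  | insert ψ F _ ih =>
    obtain ⟨φ₁, h₁⟩ := ih
      (fun p => ∃ q, (∀ φ ∈ F, holds p φ ↔ holds q φ) ∧ holds q ψ ∧ Q q)
      (fun p p' hp ⟨q, hq, hψ, hQq⟩ =>
        ⟨q, fun φ hφ => (hp φ hφ).symm.trans (hq φ hφ), hψ, hQq⟩)
    obtain ⟨φ₀, h₀⟩ := ih
      (fun p => ∃ q, (∀ φ ∈ F, holds p φ ↔ holds q φ) ∧ ¬ holds q ψ ∧ Q q)
      (fun p p' hp ⟨q, hq, hψ, hQq⟩ =>
        ⟨q, fun φ hφ => (hp φ hφ).symm.trans (hq φ hφ), hψ, hQq⟩)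
    refine ⟨.not (.and (.not (.and ψ φ₁)) (.not (.and (.not ψ) φ₀))), fun p => ?_⟩
    simp only [holds_not, holds_and, ← h₁, ← h₀]
    have transfer : ∀ q, (∀ φ ∈ F, holds p φ ↔ holds q φ) → (holds p ψ ↔ holds q ψ) →
        Q q → Q p := by
      intro q hq hψ
      refine hQ q p fun φ hφ => ?_
      rcases Finset.mem_insert.1 hφ with rfl | hφ
      · exact hψ.symm
      · exact (hq φ hφ).symm
    constructor
    · rintro hp ⟨hn₁, hn₀⟩
      by_cases hψ : holds p ψ
      · exact hn₁ ⟨hψ, p, fun _ _ => Iff.rfl, hψ, hp⟩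
      · exact hn₀ ⟨hψ, p, fun _ _ => Iff.rfl, hψ, hp⟩
    · intro h
      by_contra hp
      refine h ⟨?_, ?_⟩
      · rintro ⟨hψ, q, hq, hψq, hQq⟩
        exact hp (transfer q hq (iff_of_true hψ hψq) hQq)
      · rintro ⟨hψ, q, hq, hψq, hQq⟩
        exact hp (transfer q hq (iff_of_false hψ hψq) hQq)

/-- If the pairs `(a F, b F)` and `(c F, d F)` agree on `F` for each finite set `F` of formulas,
then the corresponding pairs of the ultraproducts along `Filter.atTop` have the same 2-type. -/
theorem type2_ultraStr_eq {L : Type} (U : Ultrafilter (Finset (FO2 L)))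
    (hU : (U : Filter (Finset (FO2 L))) ≤ Filter.atTop) {M N : Finset (FO2 L) → Type}
    (S : ∀ F, Str L (M F)) (T : ∀ F, Str L (N F))
    (a b : ∀ F, M F) (c d : ∀ F, N F)
    (h : ∀ F, ∀ φ ∈ F, Sat2 (S F) φ (a F) (b F) ↔ Sat2 (T F) φ (c F) (d F)) :
    Type2 (ultraStr U S) (Quotient.mk _ a) (Quotient.mk _ b) =
      Type2 (ultraStr U T) (Quotient.mk _ c) (Quotient.mk _ d) := by
  ext φ
  refine (sat2_ultraStr U S φ a b).trans (Iff.trans ?_ (sat2_ultraStr U T φ c d).symm)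
  refine Filter.eventually_congr (hU ?_)
  filter_upwards [Filter.eventually_ge_atTop ({φ} : Finset (FO2 L))] with F hF
  exact h F φ (hF (Finset.mem_singleton_self φ))

/-- Renaming of variables. -/
def rename {L V : Type} (σ : V → V) : FOV L V → FOV L V
  | .eq i j => .eq (σ i) (σ j)
  | .rel r i j => .rel r (σ i) (σ j)
  | .not φ => .not (rename σ φ)
  | .and φ ψ => .and (rename σ φ) (rename σ ψ)
  | .ex i φ => .ex (σ i) (rename σ φ)

theorem sat_rename {L V M : Type} [DecidableEq V] (S : Str L M) {σ : V → V}
    (hσ : Function.Injective σ) (φ : FOV L V) (v : V → M) :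
    Sat S (rename σ φ) v ↔ Sat S φ (v ∘ σ) := by
  induction φ generalizing v with
  | eq | rel => rfl
  | not φ ih => simp only [rename, Sat, ih]
  | and φ ψ ih₁ ih₂ => simp only [rename, Sat, ih₁, ih₂]
  | ex i φ ih => simp only [rename, Sat, ih, Function.update_comp_eq_of_injective v hσ]

/-- The formula expressing `φ(i, j)`. -/
def substVars {L : Type} (φ : FO2 L) (i j : Fin 2) : FO2 L :=
  if i = j then .ex (j + 1) (.and (.eq 0 1) φ)
  else if i = 0 then φ else rename (Equiv.swap 0 1) φ

theorem sat_substVars {L M : Type} (S : Str L M) (φ : FO2 L) (i j : Fin 2) (v : Fin 2 → M) :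
    Sat S (substVars φ i j) v ↔ Sat2 S φ (v i) (v j) := by
  have update_zero : ∀ m, Function.update v 0 m = ![m, v 1] := by
    intro m; funext x; fin_cases x <;> simp
  have update_one : ∀ m, Function.update v 1 m = ![v 0, m] := by
    intro m; funext x; fin_cases x <;> simp
  fin_cases i <;> fin_cases j
  · simp [substVars, Sat, Sat2, update_one]
  · have hv : v = ![v 0, v 1] := by funext x; fin_cases x <;> rfl
    simp only [substVars, Sat2]
    simp [← hv]
  · have hv : v ∘ Equiv.swap 0 1 = ![v 1, v 0] := by
      funext x; fin_cases x <;> simp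
    simp [substVars, Sat2, sat_rename S (Equiv.injective _), hv]
  · simp [substVars, Sat, Sat2, update_zero]

/-- Substitution of `φ` for the new relation symbol. -/
def substRel {L : Type} (φ : FO2 L) : FO2 (L ⊕ Unit) → FO2 L
  | .eq i j => .eq i j
  | .rel (.inl r) i j => .rel r i j
  | .rel (.inr _) i j => substVars φ i j
  | .not χ => .not (substRel φ χ)
  | .and χ ψ => .and (substRel φ χ) (substRel φ ψ)
  | .ex i χ => .ex i (substRel φ χ)

theorem sat_substRel {L M : Type} (S : Str L M) (φ : FO2 L) (χ : FO2 (L ⊕ Unit))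
    (v : Fin 2 → M) :
    Sat S (substRel φ χ) v ↔ Sat (expand S (Sat2 S φ)) χ v := by
  induction χ generalizing v with
  | eq => rfl
  | rel r i j =>
    cases r with
    | inl r => rfl
    | inr r => exact sat_substVars S φ i j v
  | not χ ih => simp only [substRel, Sat, ih]
  | and χ ψ ih₁ ih₂ => simp only [substRel, Sat, ih₁, ih₂]
  | ex i χ ih => simp only [substRel, Sat, ih]

/-- The 2-type of a pair determines which formulas hold under all valuations. -/
theorem forall_sat_of_type2_eq {L M N : Type} {S : Str L M} {T : Str L N} {a b : M} {c d : N}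
    (h : Type2 S a b = Type2 T c d) {χ : FO2 L} (hχ : ∀ v, Sat S χ v) (v : Fin 2 → N) :
    Sat T χ v := by
  by_contra hv
  have hmem : (.ex 0 (.ex 1 (.not χ)) : FO2 L) ∈ Type2 T c d := by
    refine ⟨v 0, v 1, ?_⟩
    have : Function.update (Function.update ![c, d] 0 (v 0)) 1 (v 1) = v := by
      funext x; fin_cases x <;> simp
    rwa [this]
  rw [← h] at hmem
  obtain ⟨m, n, hmn⟩ := hmem
  exact hmn (hχ _)

/-- A relation of a model that no formula defines is cut in some model (an ultrapower). -/
theorem exists_cut_of_not_definable {L M : Type} {Th : Set (FO2 L)} {Sg : Set (FO2 (L ⊕ Unit))}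
    (S : Str L M) (R : M → M → Prop) (hTh : ModelsSet S Th) (hSg : ModelsSet (expand S R) Sg)
    (hR : ¬ ∃ φ : FO2 L, R = Sat2 S φ) :
    ∃ (N : Type) (S' : Str L N) (R' : N → N → Prop) (a b c d : N),
      ModelsSet S' Th ∧ ModelsSet (expand S' R') Sg ∧ R' a b ∧ ¬ R' c d ∧
        Type2 S' a b = Type2 S' c d := by
  have key : ∀ F : Finset (FO2 L), ∃ p q : M × M,
      (∀ φ ∈ F, Sat2 S φ p.1 p.2 ↔ Sat2 S φ q.1 q.2) ∧ R p.1 p.2 ∧ ¬ R q.1 q.2 := by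
    intro F
    by_contra! hF
    obtain ⟨φ, hφ⟩ := exists_formula_of_finset
      (fun (p : M × M) φ => Sat2 S φ p.1 p.2) (fun _ => rfl) (fun _ _ => Iff.rfl)
      (fun _ _ _ => Iff.rfl) F (fun p => R p.1 p.2) hF
    exact hR ⟨φ, funext₂ fun a b => propext (hφ (a, b))⟩
  choose p q hpq hp hq using key
  obtain ⟨U, hU⟩ := Ultrafilter.exists_le (Filter.atTop : Filter (Finset (FO2 L)))
  refine ⟨_, ultraStr U fun _ => S, ultraRel U fun _ => R,
    Quotient.mk _ fun F => (p F).1, Quotient.mk _ fun F => (p F).2,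
    Quotient.mk _ fun F => (q F).1, Quotient.mk _ fun F => (q F).2,
    modelsSet_ultraStr U _ fun _ => hTh, ?_, ?_, ?_, ?_⟩
  · rw [expand_ultraStr]
    exact modelsSet_ultraStr U _ fun _ => hSg
  · exact (ultraRel_mk U _ _ _).2 (Filter.Eventually.of_forall hp)
  · rw [ultraRel_mk, ← Ultrafilter.eventually_not]
    exact Filter.Eventually.of_forall hq
  · exact type2_ultraStr_eq U hU _ _ _ _ _ _ hpq

/-- A model of `Th ∪ Sg` together with a pair of its elements. -/
structure PointedModel_s13 (L : Type) (Th : Set (FO2 L)) (Sg : Set (FO2 (L ⊕ Unit))) where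
  /-- The universe. -/
  carrier : Type
  /-- The interpretation of `L`. -/
  str : Str L carrier
  /-- The interpretation of the new relation symbol. -/
  rel : carrier → carrier → Prop
  /-- The first element of the pair. -/
  fst : carrier
  /-- The second element of the pair. -/
  snd : carrier
  models_th : ModelsSet str Th
  models_sg : ModelsSet (expand str rel) Sg

/-- If the new relation cannot be made explicit, then some 2-type is realized both inside and
outside of it, possibly in two different models. -/
theorem exists_pointedModel_of_not_madeExplicit {L : Type} {Th : Set (FO2 L)}
    {Sg : Set (FO2 (L ⊕ Unit))} (hnot : ¬ MadeExplicit L Th Sg) :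
    ∃ p q : PointedModel_s13 L Th Sg, p.rel p.fst p.snd ∧ ¬ q.rel q.fst q.snd ∧
      Type2 p.str p.fst p.snd = Type2 q.str q.fst q.snd := by
  have key : ∀ F : Finset (FO2 L), ∃ p q : PointedModel_s13 L Th Sg,
      (∀ φ ∈ F, Sat2 p.str φ p.fst p.snd ↔ Sat2 q.str φ q.fst q.snd) ∧
        p.rel p.fst p.snd ∧ ¬ q.rel q.fst q.snd := by
    intro F
    by_contra! hF
    obtain ⟨φ, hφ⟩ := exists_formula_of_finset
      (fun (p : PointedModel_s13 L Th Sg) φ => Sat2 p.str φ p.fst p.snd) (fun _ => rfl)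
      (fun _ _ => Iff.rfl) (fun _ _ _ => Iff.rfl) F (fun p => p.rel p.fst p.snd) hF
    exact hnot ⟨φ, fun M S _ hTh R hSg a b => hφ ⟨M, S, R, a, b, hTh, hSg⟩⟩
  choose p q hpq hp hq using key
  obtain ⟨U, hU⟩ := Ultrafilter.exists_le (Filter.atTop : Filter (Finset (FO2 L)))
  let ultra (r : Finset (FO2 L) → PointedModel_s13 L Th Sg) : PointedModel_s13 L Th Sg :=
    { carrier := Ultraproduct U fun F => (r F).carrier
      str := ultraStr U fun F => (r F).str
      rel := ultraRel U fun F => (r F).rel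
      fst := Quotient.mk _ fun F => (r F).fst
      snd := Quotient.mk _ fun F => (r F).snd
      models_th := modelsSet_ultraStr U _ fun F => (r F).models_th
      models_sg := by
        rw [expand_ultraStr]
        exact modelsSet_ultraStr U _ fun F => (r F).models_sg }
  refine ⟨ultra p, ultra q, ?_, ?_, ?_⟩
  · exact (ultraRel_mk U _ _ _).2 (Filter.Eventually.of_forall hp)
  · refine fun h => ?_
    have h := ((ultraRel_mk U _ _ _).1 h).and (Filter.Eventually.of_forall hq)
    obtain ⟨F, hF, hF'⟩ := h.exists
    exact hF' hF
  · exact type2_ultraStr_eq U hU _ _ _ _ _ _ hpq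

/-- If a weak implicit definition Σ cannot be made explicit,
then there is a complete 2-type T that is cut by R in some model of Th ∪ Σ. -/
theorem stmt13 (L : Type) (Th : Set (FO2 L)) (Sg : Set (FO2 (L ⊕ Unit)))
    (hTh : ∀ φ ∈ Th, Sentence φ) (hSg : ∀ φ ∈ Sg, Sentence φ)
    (hweak : WeakImplicitDef L Th Sg)
    (hnot : ¬ MadeExplicit L Th Sg) :
    ∃ T : Set (FO2 L), (∀ φ : FO2 L, φ ∈ T ∨ FOV.not φ ∈ T) ∧
      ∃ (M : Type) (S : Str L M) (R : M → M → Prop) (a b c d : M),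
        Nonempty M ∧ ModelsSet S Th ∧ ModelsSet (expand S R) Sg ∧
        R a b ∧ ¬ R c d ∧ Type2 S a b = T ∧ Type2 S c d = T := by
  suffices h : ∃ (M : Type) (S : Str L M) (R : M → M → Prop) (a b c d : M),
      ModelsSet S Th ∧ ModelsSet (expand S R) Sg ∧ R a b ∧ ¬ R c d ∧
        Type2 S a b = Type2 S c d by
    obtain ⟨M, S, R, a, b, c, d, hS, hR, hab, hcd, htype⟩ := h
    exact ⟨Type2 S a b, fun φ => em (Sat2 S φ a b), M, S, R, a, b, c, d, ⟨a⟩, hS, hR, hab, hcd,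
      rfl, htype.symm⟩
  obtain ⟨p, q, hp, hq, hpq⟩ := exists_pointedModel_of_not_madeExplicit hnot
  by_cases hdef : ∃ φ : FO2 L, p.rel = Sat2 p.str φ
  · obtain ⟨φ, hφ⟩ := hdef
    have hmodels : ModelsSet (expand q.str (Sat2 q.str φ)) Sg := by
      intro χ hχ v
      rw [← sat_substRel]
      refine forall_sat_of_type2_eq hpq (fun w => ?_) v
      rw [sat_substRel, ← hφ]
      exact p.models_sg χ hχ w
    have hrel : q.rel = Sat2 q.str φ :=
      hweak q.carrier q.str ⟨q.fst⟩ q.models_th _ _ q.models_sg hmodels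
    have hmem : φ ∈ Type2 p.str p.fst p.snd := by rwa [hφ] at hp
    rw [hpq] at hmem
    exact (hq (by rw [hrel]; exact hmem)).elim
  · exact exists_cut_of_not_definable p.str p.rel p.models_th p.models_sg hdef

end AN
end

section
/- Let L be a binary relational language, let I be a 2-isomorphism between L-structures M and M̄, and let R̄ ⊆ M̄ × M̄ be a relation that does not cut 2-types in M̄. Define R = {(a,b) ∈ M × M : there exist c,d ∈ M̄ with R̄(c,d) and Type(a,b,M) = Type(c,d,M̄)}. Then I is a 2-isomorphism between the expanded structures (M,R) and (M̄,R̄) in the language L ∪ {R}. -/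
namespace AN

/-- Two valuations of the variables x, y are matched by `(i1, i2)` when they are related as
pairs, in either order, or are both constant with related values. -/
def Matched {M N : Type} (i1 : M → N → Prop) (i2 : M → M → N → N → Prop)
    (v : Fin 2 → M) (w : Fin 2 → N) : Prop :=
  i2 (v 0) (v 1) (w 0) (w 1) ∨ i2 (v 1) (v 0) (w 1) (w 0) ∨
    (v 0 = v 1 ∧ w 0 = w 1 ∧ i1 (v 0) (w 0))

namespace IsTwoIso

variable {L M N : Type} {S : Str L M} {T : Str L N}
  {i1 : M → N → Prop} {i2 : M → M → N → N → Prop} {v : Fin 2 → M} {w : Fin 2 → N}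

theorem i1_of_matched (h : IsTwoIso S T i1 i2) (hm : Matched i1 i2 v w) (i : Fin 2) :
    i1 (v i) (w i) := by
  rcases hm with hm | hm | ⟨hv, hw, hm⟩
  · have := h.restrict _ _ _ _ hm
    fin_cases i
    exacts [this.1, this.2]
  · have := h.restrict _ _ _ _ hm
    fin_cases i
    exacts [this.2, this.1]
  · fin_cases i
    exacts [hm, by simpa [← hv, ← hw] using hm]

theorem eq_iff_of_matched (h : IsTwoIso S T i1 i2) (hm : Matched i1 i2 v w) (i j : Fin 2) :
    v i = v j ↔ w i = w j := by
  have h01 : v 0 = v 1 ↔ w 0 = w 1 := by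
    rcases hm with hm | hm | ⟨hv, hw, -⟩
    · exact h.eq_iff _ _ _ _ hm
    · exact eq_comm.trans ((h.eq_iff _ _ _ _ hm).trans eq_comm)
    · exact iff_of_true hv hw
  fin_cases i <;> fin_cases j
  exacts [iff_of_true rfl rfl, h01, eq_comm.trans (h01.trans eq_comm), iff_of_true rfl rfl]

theorem rel_iff_of_matched (h : IsTwoIso S T i1 i2) (hm : Matched i1 i2 v w) (r : L)
    (i j : Fin 2) : S r (v i) (v j) ↔ T r (w i) (w j) := by
  rcases hm with hm | hm | ⟨hv, hw, hm⟩
  · obtain ⟨h₀₀, h₀₁, h₁₀, h₁₁⟩ := h.rel_iff2 _ _ _ _ hm r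
    fin_cases i <;> fin_cases j <;> assumption
  · obtain ⟨h₁₁, h₁₀, h₀₁, h₀₀⟩ := h.rel_iff2 _ _ _ _ hm r
    fin_cases i <;> fin_cases j <;> assumption
  · have := h.rel_iff1 _ _ hm r
    fin_cases i <;> fin_cases j <;> simpa [← hv, ← hw] using this

theorem exists_matched_update (h : IsTwoIso S T i1 i2) (hm : Matched i1 i2 v w) (i : Fin 2)
    (m : M) : ∃ n, Matched i1 i2 (Function.update v i m) (Function.update w i n) := by
  fin_cases i
  · obtain ⟨n, hn⟩ := h.forth2 _ _ (h.i1_of_matched hm 1) m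
    exact ⟨n, .inr (.inl (by simpa using hn))⟩
  · obtain ⟨n, hn⟩ := h.forth2 _ _ (h.i1_of_matched hm 0) m
    exact ⟨n, .inl (by simpa using hn)⟩

theorem exists_matched_update_back (h : IsTwoIso S T i1 i2) (hm : Matched i1 i2 v w)
    (i : Fin 2) (n : N) :
    ∃ m, Matched i1 i2 (Function.update v i m) (Function.update w i n) := by
  fin_cases i
  · obtain ⟨m, hn⟩ := h.back2 _ _ (h.i1_of_matched hm 1) n
    exact ⟨m, .inr (.inl (by simpa using hn))⟩
  · obtain ⟨m, hn⟩ := h.back2 _ _ (h.i1_of_matched hm 0) n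
    exact ⟨m, .inl (by simpa using hn)⟩

/-- Matched valuations satisfy the same two-variable formulas. -/
theorem sat_iff_of_matched (h : IsTwoIso S T i1 i2) (φ : FO2 L) (hm : Matched i1 i2 v w) :
    Sat S φ v ↔ Sat T φ w := by
  induction φ generalizing v w with
  | eq i j => exact h.eq_iff_of_matched hm i j
  | rel r i j => exact h.rel_iff_of_matched hm r i j
  | not φ ih => exact not_congr (ih hm)
  | and φ ψ ihφ ihψ => exact and_congr (ihφ hm) (ihψ hm)
  | ex i φ ih =>
    constructor
    · rintro ⟨m, hs⟩
      obtain ⟨n, hn⟩ := h.exists_matched_update hm i m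
      exact ⟨n, (ih hn).1 hs⟩
    · rintro ⟨n, hs⟩
      obtain ⟨m, hn⟩ := h.exists_matched_update_back hm i n
      exact ⟨m, (ih hn).2 hs⟩

theorem type2_eq_of_matched (h : IsTwoIso S T i1 i2) {a b : M} {a' b' : N}
    (hm : Matched i1 i2 ![a, b] ![a', b']) : Type2 S a b = Type2 T a' b' :=
  Set.ext fun φ => h.sat_iff_of_matched φ hm

end IsTwoIso

/-- A relation that does not cut 2-types agrees with its pullback along equality of 2-types. -/
theorem NoCut.exists_type2_eq_iff {L M N : Type} {S : Str L M} {T : Str L N}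
    {R : N → N → Prop} (hR : NoCut T R) {a b : M} {a' b' : N}
    (hab : Type2 S a b = Type2 T a' b') :
    (∃ c d, R c d ∧ Type2 S a b = Type2 T c d) ↔ R a' b' :=
  ⟨fun ⟨_, _, hcd, ht⟩ => (hR _ _ _ _ (ht.symm.trans hab)).1 hcd,
    fun hr => ⟨a', b', hr, hab⟩⟩

/-- Transferring a relation that does not cut 2-types along a
2-isomorphism: the same 2-isomorphism works for the expanded structures. -/
theorem stmt14 (L M N : Type) (S : Str L M) (T : Str L N)
    (i1 : M → N → Prop) (i2 : M → M → N → N → Prop)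
    (h : IsTwoIso S T i1 i2) (R' : N → N → Prop) (hnc : NoCut T R') :
    IsTwoIso
      (expand S (fun a b => ∃ c d, R' c d ∧ Type2 S a b = Type2 T c d))
      (expand T R') i1 i2 := by
  have diag : ∀ a a', i1 a a' → Matched i1 i2 ![a, a] ![a', a'] := fun _ _ ha =>
    .inr (.inr ⟨rfl, rfl, ha⟩)
  have transfer : ∀ {a b a' b'}, Matched i1 i2 ![a, b] ![a', b'] →
      ((∃ c d, R' c d ∧ Type2 S a b = Type2 T c d) ↔ R' a' b') := fun hm =>
    hnc.exists_type2_eq_iff (h.type2_eq_of_matched hm)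
  refine { h with rel_iff2 := ?_, rel_iff1 := ?_ }
  · rintro a b a' b' hi (r | -)
    · exact h.rel_iff2 a b a' b' hi r
    · obtain ⟨ha, hb⟩ := h.restrict _ _ _ _ hi
      exact ⟨transfer (diag _ _ ha), transfer (.inl hi), transfer (.inr (.inl hi)),
        transfer (diag _ _ hb)⟩
  · rintro a a' ha (r | -)
    · exact h.rel_iff1 a a' ha r
    · exact transfer (diag _ _ ha)

end AN
end
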